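/- arXiv:math/0211278 — 5 statements merged into one kernel-verified Lean document; each statement's English description precedes it below -/
import Mathlib

section
/- Let K be the field of Puiseux series over ℂ with valuation Val, let k ≥ 2, n ≥ 1, and let I ⊂ ℤ^k be a finite set of n+1 points. Then for a generic n-tuple (x_1, …, x_n) ∈ (ℝ^k)^n (excluding finitely many hyperplanes), there exists exactly one amoeba A ∈ 𝒜(I) (i.e., a set of the form Val({f=0}) for some Laurent polynomial f with support I and nonzero coefficients) passing through x_1, …, x_n. -/
open Finset

open scoped Classical in
/-- The multiplicative form `exp ∘ Val` of an additively written non-Archimedean valuation. -/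
noncomputable def Valuation.ofReal {K : Type*} [Field K] (Val : K → ℝ)
    (hmul : ∀ a b : K, a ≠ 0 → b ≠ 0 → Val (a * b) = Val a + Val b)
    (hadd : ∀ a b : K, a ≠ 0 → b ≠ 0 → a + b ≠ 0 → Val (a + b) ≤ max (Val a) (Val b)) :
    Valuation K NNReal where
  toFun a := if a = 0 then 0 else (Real.exp (Val a)).toNNReal
  map_zero' := if_pos rfl
  map_one' := by
    have h := hmul 1 1 one_ne_zero one_ne_zero
    have h1 : Val 1 = 0 := by simpa using h
    simp [h1]
  map_mul' a b := by
    by_cases ha : a = 0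
    · simp [ha]
    by_cases hb : b = 0
    · simp [hb]
    simp [ha, hb, hmul a b ha hb, Real.exp_add, Real.toNNReal_mul (Real.exp_pos _).le]
  map_add_le_max' a b := by
    by_cases ha : a = 0
    · simp [ha]
    by_cases hb : b = 0
    · simp [hb]
    by_cases hab : a + b = 0
    · simp [hab]
    rw [if_neg ha, if_neg hb, if_neg hab, le_max_iff]
    exact (le_max_iff.1 (hadd a b ha hb hab)).imp
      (fun h => Real.toNNReal_mono (Real.exp_le_exp.2 h))
      fun h => Real.toNNReal_mono (Real.exp_le_exp.2 h)

theorem Valuation.coe_ofReal {K : Type*} [Field K] (Val : K → ℝ) (hmul) (hadd) {a : K}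
    (ha : a ≠ 0) : (Valuation.ofReal Val hmul hadd a : ℝ) = Real.exp (Val a) := by
  classical
  change ((if a = 0 then 0 else (Real.exp (Val a)).toNNReal : NNReal) : ℝ) = _
  rw [if_neg ha, Real.coe_toNNReal _ (Real.exp_pos _).le]

section Valued

variable {K : Type*} [Field K] (v : Valuation K NNReal)

/-- A polynomial has a dominant coefficient if all its roots have valuation different from `1`. -/
theorem exists_dominant_coeff_prod_X_sub_C (s : Multiset K) (hs : ∀ r ∈ s, v r ≠ 1) :
    ∃ d, ∀ i ≠ d, v ((s.map fun r => Polynomial.X - Polynomial.C r).prod.coeff i) <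
      v ((s.map fun r => Polynomial.X - Polynomial.C r).prod.coeff d) := by
  induction s using Multiset.induction_on with
  | empty =>
    refine ⟨0, fun i hi => ?_⟩
    simp [Polynomial.coeff_one, hi]
  | cons r s ih =>
    obtain ⟨d, hd⟩ := ih fun r hr => hs r (Multiset.mem_cons_of_mem hr)
    rw [Multiset.map_cons, Multiset.prod_cons]
    set P := (s.map fun r => Polynomial.X - Polynomial.C r).prod
    have hpos : 0 < v (P.coeff d) := pos_of_gt (hd (d + 1) (by simp))
    have hle : ∀ i, v (P.coeff i) ≤ v (P.coeff d) := fun i => by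
      by_cases h : i = d
      · rw [h]
      · exact (hd i h).le
    have hz : ((Polynomial.X - Polynomial.C r) * P).coeff 0 = -(r * P.coeff 0) := by
      simp [sub_mul]
    have hsucc : ∀ i, ((Polynomial.X - Polynomial.C r) * P).coeff (i + 1) =
        P.coeff i - r * P.coeff (i + 1) := fun i => by
      simp [sub_mul, Polynomial.coeff_X_mul]
    rcases lt_or_gt_of_ne (hs r (Multiset.mem_cons_self r s)) with hr | hr
    · have hsmall : ∀ i, v (r * P.coeff i) < v (P.coeff d) := fun i => by
        rw [map_mul]
        calc v r * v (P.coeff i) ≤ v r * v (P.coeff d) := by gcongr; exact hle i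
          _ < v (P.coeff d) := mul_lt_of_lt_one_left hpos hr
      refine ⟨d + 1, fun i hi => ?_⟩
      rw [hsucc d, v.map_sub_eq_of_lt_left (hsmall _)]
      cases i with
      | zero => rw [hz, v.map_neg]; exact hsmall 0
      | succ i => rw [hsucc]; exact v.map_sub_lt (hd i (by simpa using hi)) (hsmall _)
    · have hbig : v (P.coeff d) < v (r * P.coeff d) := by
        rw [map_mul]; exact lt_mul_of_one_lt_left hpos hr
      have hlt : ∀ i ≠ d, v (r * P.coeff i) < v (r * P.coeff d) := fun i hi => by
        rw [map_mul, map_mul]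
        exact mul_lt_mul_of_pos_left (hd i hi) (zero_lt_one.trans hr)
      have hval : v (((Polynomial.X - Polynomial.C r) * P).coeff d) = v (r * P.coeff d) := by
        cases h : d with
        | zero => rw [hz, v.map_neg]
        | succ e =>
          rw [hsucc, ← h]
          exact v.map_sub_eq_of_lt_right ((hle e).trans_lt hbig)
      refine ⟨d, fun i hi => ?_⟩
      rw [hval]
      cases i with
      | zero => rw [hz, v.map_neg]; exact hlt 0 hi
      | succ i => rw [hsucc]; exact v.map_sub_lt ((hle i).trans_lt hbig) (hlt _ hi)

/-- A polynomial whose largest coefficient valuation is attained twice has a root of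
valuation `1`. -/
theorem Polynomial.exists_isRoot_valuation_eq_one [IsAlgClosed K] (P : Polynomial K)
    {a b : ℕ} (hab : a ≠ b) (ha : P.coeff a ≠ 0) (hle : ∀ i, v (P.coeff i) ≤ v (P.coeff a))
    (hb : v (P.coeff b) = v (P.coeff a)) : ∃ u, P.IsRoot u ∧ v u = 1 := by
  by_contra! h
  have hP : P ≠ 0 := by rintro rfl; simp at ha
  obtain ⟨d, hd⟩ := exists_dominant_coeff_prod_X_sub_C v P.roots fun r hr =>
    h r ((Polynomial.mem_roots hP).1 hr)
  have hlc : 0 < v P.leadingCoeff := v.pos_iff.2 (Polynomial.leadingCoeff_ne_zero.2 hP)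
  have hd' : ∀ i ≠ d, v (P.coeff i) < v (P.coeff d) := fun i hi => by
    rw [(IsAlgClosed.splits P).eq_prod_roots]
    simp only [Polynomial.coeff_C_mul, map_mul]
    exact mul_lt_mul_of_pos_left (hd i hi) hlc
  by_cases hda : a = d
  · exact (hd' b (hda ▸ hab.symm)).ne (hda ▸ hb)
  · exact (hd' a hda).not_ge (hle d)

/-- If the largest valuation in a family of terms is attained twice, twisting the terms by
distinct powers of a suitable element of valuation `1` makes their sum vanish. -/
theorem exists_sum_mul_zpow_eq_zero [IsAlgClosed K] {ι : Type*} [Fintype ι] (t : ι → K)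
    (e : ι → ℤ) (he : Function.Injective e) {a b : ι} (hab : a ≠ b) (ha : t a ≠ 0)
    (hle : ∀ i, v (t i) ≤ v (t a)) (hb : v (t b) = v (t a)) :
    ∃ u : K, v u = 1 ∧ ∑ i, t i * u ^ e i = 0 := by
  classical
  obtain ⟨N, hN⟩ : ∃ N : ℤ, ∀ i, 0 ≤ e i + N :=
    ⟨∑ i, |e i|, fun i => by
      have := single_le_sum (f := fun i => |e i|) (fun i _ => abs_nonneg _) (mem_univ i)
      have := neg_abs_le (e i)
      grind⟩
  choose g hg using fun i => Int.eq_ofNat_of_zero_le (hN i)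
  have hginj : Function.Injective g := fun i j hij => he (by grind)
  let P : Polynomial K := ∑ i, Polynomial.monomial (g i) (t i)
  have hcoeff : ∀ i, P.coeff (g i) = t i := fun i => by
    simp [P, Polynomial.finsetSum_coeff, Polynomial.coeff_monomial, hginj.eq_iff]
  have hzero : ∀ m, (∀ i, g i ≠ m) → P.coeff m = 0 := fun m hm => by
    simp [P, Polynomial.finsetSum_coeff, Polynomial.coeff_monomial, hm]
  obtain ⟨u, hu, hvu⟩ := P.exists_isRoot_valuation_eq_one v (hginj.ne hab)
    (by rwa [hcoeff]) (fun m => by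
      by_cases h : ∃ i, g i = m
      · obtain ⟨i, rfl⟩ := h
        rw [hcoeff, hcoeff]
        exact hle i
      · rw [hzero m (by simpa using h), map_zero]
        exact zero_le) (by rw [hcoeff, hcoeff, hb])
  have hu0 : u ≠ 0 := by rintro rfl; simp at hvu
  refine ⟨u, hvu, ?_⟩
  have h : ∑ i, t i * u ^ g i = 0 := by
    simpa [P, Polynomial.IsRoot, Polynomial.eval_finsetSum] using hu
  have h2 : (∑ i, t i * u ^ e i) * u ^ N = 0 := by
    rw [sum_mul, ← h]
    refine sum_congr rfl fun i _ => ?_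
    rw [mul_assoc, ← zpow_add₀ hu0, hg i]
    simp
  exact (mul_eq_zero.1 h2).resolve_right (zpow_ne_zero _ hu0)

/-- In a vanishing sum of nonzero terms the largest valuation is attained twice. -/
theorem exists_valuation_eq_of_sum_eq_zero {ι : Type*} [Fintype ι] [Nonempty ι] (t : ι → K)
    (ht : ∀ i, t i ≠ 0) (h : ∑ i, t i = 0) :
    ∃ a b, a ≠ b ∧ (∀ i, v (t i) ≤ v (t a)) ∧ v (t b) = v (t a) := by
  classical
  obtain ⟨a, ha⟩ := Finite.exists_max fun i => v (t i)
  by_contra! hcon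
  have := v.map_sum_eq_of_lt (s := univ) (f := t) (mem_univ a) fun i hi =>
    lt_of_le_of_ne (ha i) (hcon a i (by simpa [eq_comm] using hi) ha)
  rw [h, map_zero] at this
  exact ht a (v.zero_iff.1 this.symm)

/-- The valuation of a sum of terms with distinct valuations depends only on the valuations
of the terms. -/
theorem valuation_sum_eq_valuation_sum {ι : Type*} [Fintype ι] [Nonempty ι] {s t : ι → K}
    (hs : ∀ i, s i ≠ 0) (hinj : Function.Injective fun i => v (s i))
    (hst : ∀ i, v (s i) = v (t i)) : v (∑ i, s i) = v (∑ i, t i) ∧ ∑ i, s i ≠ 0 := by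
  classical
  obtain ⟨a, ha⟩ := Finite.exists_max fun i => v (s i)
  have hlt : ∀ i ∈ univ \ {a}, v (s i) < v (s a) := fun i hi =>
    lt_of_le_of_ne (ha i) (hinj.ne (by simpa using hi))
  have hsum := v.map_sum_eq_of_lt (mem_univ a) hlt
  refine ⟨?_, ?_⟩
  · rw [hsum, v.map_sum_eq_of_lt (mem_univ a) (by simpa only [hst] using hlt), hst]
  · rw [← v.ne_zero_iff, hsum, v.ne_zero_iff]
    exact hs a

/-- The valuation of a determinant whose expansion has terms with distinct valuations depends
only on the valuations of the entries. -/
theorem valuation_det_eq_valuation_det {m : Type*} [Fintype m] [DecidableEq m]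
    {A B : Matrix m m K} (hA : ∀ i j, A i j ≠ 0) (hAB : ∀ i j, v (A i j) = v (B i j))
    (hinj : Function.Injective fun σ : Equiv.Perm m => ∏ i, v (A i (σ i))) :
    v A.det = v B.det ∧ A.det ≠ 0 := by
  have hv : ∀ (M : Matrix m m K) (σ : Equiv.Perm m),
      v ((Equiv.Perm.sign σ : ℤ) * ∏ i, M i (σ i)) = ∏ i, v (M i (σ i)) := fun M σ => by
    rcases Int.units_eq_one_or (Equiv.Perm.sign σ) with h | h <;> simp [h, map_prod]
  rw [← A.det_transpose, ← B.det_transpose, Matrix.det_apply', Matrix.det_apply']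
  refine valuation_sum_eq_valuation_sum v (fun σ => ?_) ?_ fun σ => ?_
  · rw [← v.ne_zero_iff, Matrix.transpose]
    simp only [Matrix.of_apply, hv]
    exact prod_ne_zero_iff.2 fun i _ => v.ne_zero_iff.2 (hA _ _)
  · simpa only [Matrix.transpose_apply, hv] using hinj
  · simp only [Matrix.transpose_apply, hv, hAB]

/-- Cramer's rule for a homogeneous system of `n` equations in `n + 1` unknowns. -/
theorem Matrix.mul_det_submatrix_succ_of_mulVec_eq_zero {n : ℕ}
    {M : Matrix (Fin n) (Fin (n + 1)) K} {c : Fin (n + 1) → K} (h : M.mulVec c = 0) (l : Fin n) :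
    c l.succ * (M.submatrix id Fin.succ).det =
      -(c 0 * (M.submatrix id (Function.update Fin.succ l 0)).det) := by
  set N := M.submatrix id Fin.succ with hN
  have hcol : M.submatrix id (Function.update Fin.succ l 0) = N.updateCol l fun i => M i 0 := by
    ext i j
    by_cases hj : j = l
    · subst hj; simp
    · simp [hN, hj]
  have hmv : N.mulVec (c ∘ Fin.succ) = -(c 0 • fun i => M i 0) := by
    ext i
    have := congrFun h i
    simp only [Matrix.mulVec, dotProduct, Fin.sum_univ_succ, Pi.zero_apply] at this
    simp only [hN, Matrix.mulVec, dotProduct, Matrix.submatrix_apply, id, Function.comp_apply,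
      Pi.neg_apply, Pi.smul_apply, smul_eq_mul]
    linear_combination this
  have key : N.cramer (N.mulVec (c ∘ Fin.succ)) = N.det • (c ∘ Fin.succ) := by
    rw [Matrix.cramer_eq_adjugate_mulVec, Matrix.mulVec_mulVec, Matrix.adjugate_mul,
      Matrix.smul_mulVec, Matrix.one_mulVec]
  rw [hmv, map_neg, map_smul] at key
  have := congrFun key l
  simp only [Pi.neg_apply, Pi.smul_apply, smul_eq_mul, Function.comp_apply,
    Matrix.cramer_apply] at this
  rw [hcol]
  linear_combination -this

theorem Fin.injective_update_succ_zero {n : ℕ} (l : Fin n) :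
    Function.Injective (Function.update Fin.succ l (0 : Fin (n + 1))) := by
  intro i j hij
  by_cases hi : i = l <;> by_cases hj : j = l
  · rw [hi, hj]
  · simp [hi, hj, (Fin.succ_ne_zero _).symm] at hij
  · simp [hi, hj] at hij
  · simpa [hi, hj] using hij

/-- The valuation of a maximal minor of a generic matrix is determined by the valuations of the
entries, and the minor does not vanish. -/
theorem valuation_det_submatrix_eq {m ι : Type*} [Fintype m] [DecidableEq m] {A B : Matrix m ι K}
    (hA : ∀ i j, A i j ≠ 0) (hAB : ∀ i j, v (A i j) = v (B i j))
    (hgen : Function.Injective fun σ : m → ι => ∏ i, v (A i (σ i))) {τ : m → ι}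
    (hτ : Function.Injective τ) :
    v (A.submatrix id τ).det = v (B.submatrix id τ).det ∧ (A.submatrix id τ).det ≠ 0 := by
  refine valuation_det_eq_valuation_det v (fun i j => hA _ _) (fun i j => hAB _ _)
    fun σ ρ hσρ => ?_
  have h : τ ∘ σ = τ ∘ ρ := hgen hσρ
  exact Equiv.ext fun i => hτ (congrFun h i)

/-- A generic system of `n` equations in `n + 1` unknowns has a solution without zero entries. -/
theorem exists_mulVec_eq_zero {n : ℕ} {M : Matrix (Fin n) (Fin (n + 1)) K}
    (hM : ∀ i j, M i j ≠ 0)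
    (hgen : Function.Injective fun σ : Fin n → Fin (n + 1) => ∏ i, v (M i (σ i))) :
    ∃ c : Fin (n + 1) → K, (∀ j, c j ≠ 0) ∧ M.mulVec c = 0 := by
  obtain ⟨c, hc, hMc⟩ := Matrix.exists_mulVec_eq_zero_iff.2
    (Matrix.det_eq_zero_of_row_eq_zero (A := (Matrix.of (Fin.cons 0 M :
      Fin (n + 1) → Fin (n + 1) → K))) 0 fun j => rfl)
  have hMc' : M.mulVec c = 0 := funext fun i => congrFun hMc i.succ
  have hdet := fun {τ} hτ => (valuation_det_submatrix_eq v hM (fun _ _ => rfl) hgen (τ := τ) hτ).2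
  have hcr := Matrix.mul_det_submatrix_succ_of_mulVec_eq_zero hMc'
  have h0 : c 0 ≠ 0 := fun h0 => hc <| funext fun j => by
    cases j using Fin.cases with
    | zero => exact h0
    | succ l => simpa [h0, hdet (Fin.succ_injective n)] using hcr l
  refine ⟨c, fun j => ?_, hMc'⟩
  cases j using Fin.cases with
  | zero => exact h0
  | succ l =>
    intro h
    simpa [h, h0, hdet (Fin.injective_update_succ_zero l)] using hcr l

/-- The valuations of the entries of a solution of a generic system of `n` equations in `n + 1`
unknowns are determined up to a common factor by the valuations of the coefficients. -/
theorem valuation_eq_mul_of_mulVec_eq_zero {n : ℕ} {A B : Matrix (Fin n) (Fin (n + 1)) K}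
    (hA : ∀ i j, A i j ≠ 0) (hAB : ∀ i j, v (A i j) = v (B i j))
    (hgen : Function.Injective fun σ : Fin n → Fin (n + 1) => ∏ i, v (A i (σ i)))
    {c d : Fin (n + 1) → K} (hc : c 0 ≠ 0) (hAc : A.mulVec c = 0) (hBd : B.mulVec d = 0)
    (j : Fin (n + 1)) : v (d j) = v (d 0) / v (c 0) * v (c j) := by
  have hc0 : v (c 0) ≠ 0 := v.ne_zero_iff.2 hc
  cases j using Fin.cases with
  | zero => rw [div_mul_cancel₀ _ hc0]
  | succ l =>
    obtain ⟨hs, hs0⟩ := valuation_det_submatrix_eq v hA hAB hgen (Fin.succ_injective n)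
    have hu := (valuation_det_submatrix_eq v hA hAB hgen (Fin.injective_update_succ_zero l)).1
    have h1 := congrArg v (Matrix.mul_det_submatrix_succ_of_mulVec_eq_zero hAc l)
    have h2 := congrArg v (Matrix.mul_det_submatrix_succ_of_mulVec_eq_zero hBd l)
    simp only [v.map_neg, map_mul] at h1 h2
    rw [← hs, ← hu] at h2
    refine mul_right_cancel₀ (v.ne_zero_iff.2 hs0) ?_
    rw [h2, mul_assoc, h1]
    field_simp

/-- Finitely many lattice points are separated by an integral linear form. -/
theorem exists_injective_sum_mul {ι : Type*} [Fintype ι] {k : ℕ} (e : ι → Fin k → ℤ)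
    (he : Function.Injective e) :
    ∃ m : Fin k → ℤ, Function.Injective fun j => ∑ a, m a * e j a := by
  classical
  let P : ι → Polynomial ℤ := fun j => ∑ a : Fin k, Polynomial.monomial (a : ℕ) (e j a)
  have hP : Function.Injective P := fun i j hij => he <| funext fun a => by
    have := congrArg (fun p => Polynomial.coeff p (a : ℕ)) hij
    simpa [P, Polynomial.finsetSum_coeff, Polynomial.coeff_monomial, Fin.val_inj] using this
  let Q := ∏ p ∈ univ.offDiag, (P p.1 - P p.2)
  have hQ : Q ≠ 0 := prod_ne_zero_iff.2 fun p hp =>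
    sub_ne_zero.2 (hP.ne (mem_offDiag.1 hp).2.2)
  obtain ⟨B, hB⟩ : ∃ B, Q.eval B ≠ 0 := by
    by_contra! h
    exact hQ (Polynomial.funext (by simpa using h))
  refine ⟨fun a => B ^ (a : ℕ), fun i j hij => ?_⟩
  by_contra hne
  rw [Polynomial.eval_prod, prod_ne_zero_iff] at hB
  refine hB (i, j) (by simp [hne]) ?_
  simp only [mul_comm] at hij
  simpa [P, Polynomial.eval_finsetSum, sub_eq_zero] using hij

/-- The amoeba of a polynomial depends only on the valuations of its coefficients, up to a common
factor. -/
theorem exists_zero_of_valuation_eq_mul [IsAlgClosed K] {ι : Type*} [Fintype ι] [Nonempty ι]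
    {k : ℕ} {e : ι → Fin k → ℤ} (he : Function.Injective e) {c d : ι → K} (hc : ∀ j, c j ≠ 0)
    (hd : ∀ j, d j ≠ 0) {r : NNReal} (hcd : ∀ j, v (d j) = r * v (c j)) {z : Fin k → K}
    (hz : ∀ a, z a ≠ 0) (h : ∑ j, c j * ∏ a, z a ^ e j a = 0) :
    ∃ y : Fin k → K, (∀ a, y a ≠ 0) ∧ ∑ j, d j * ∏ a, y a ^ e j a = 0 ∧
      ∀ a, v (y a) = v (z a) := by
  have hmon : ∀ j, ∏ a, z a ^ e j a ≠ 0 := fun j =>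
    prod_ne_zero_iff.2 fun a _ => zpow_ne_zero _ (hz a)
  obtain ⟨a, b, hab, hmax, hb⟩ :=
    exists_valuation_eq_of_sum_eq_zero v _ (fun j => mul_ne_zero (hc j) (hmon j)) h
  obtain ⟨m, hm⟩ := exists_injective_sum_mul e he
  have hval : ∀ j, v (d j * ∏ a, z a ^ e j a) = r * v (c j * ∏ a, z a ^ e j a) := fun j => by
    rw [map_mul, hcd, map_mul, mul_assoc]
  obtain ⟨u, hu, hsum⟩ := exists_sum_mul_zpow_eq_zero v (fun j => d j * ∏ a, z a ^ e j a) _ hm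
    hab (mul_ne_zero (hd a) (hmon a)) (fun i => by rw [hval, hval]; gcongr; exact hmax i)
    (by rw [hval, hval, hb])
  have hu0 : u ≠ 0 := by rintro rfl; simp at hu
  refine ⟨fun a => z a * u ^ m a, fun a => mul_ne_zero (hz a) (zpow_ne_zero _ hu0), ?_,
    fun a => by simp [hu]⟩
  rw [← hsum]
  refine sum_congr rfl fun j _ => ?_
  have hpow : u ^ ∑ a, m a * e j a = ∏ a, u ^ (m a * e j a) := by
    induction (univ : Finset (Fin k)) using Finset.induction_on with
    | empty => simp
    | insert a s ha ih => rw [sum_insert ha, prod_insert ha, zpow_add₀ hu0, ih]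
  simp only [hpow, mul_zpow, prod_mul_distrib, ← zpow_mul, mul_assoc]

end Valued

/-- The linear form on `n`-tuples of points in `ℝ^k` with integral coefficients `μ`. -/
noncomputable def exponentForm {n k : ℕ} (μ : Fin n → Fin k → ℤ) :
    (Fin n → Fin k → ℝ) →ₗ[ℝ] ℝ :=
  ∑ i, ∑ a, (μ i a : ℝ) • ((LinearMap.proj a : (Fin k → ℝ) →ₗ[ℝ] ℝ) ∘ₗ LinearMap.proj i)

theorem exponentForm_apply {n k : ℕ} (μ : Fin n → Fin k → ℤ) (x : Fin n → Fin k → ℝ) :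
    exponentForm μ x = ∑ i, ∑ a, (μ i a : ℝ) * x i a := by
  simp [exponentForm]

theorem exponentForm_ne_zero {n k : ℕ} {μ : Fin n → Fin k → ℤ} (hμ : μ ≠ 0) :
    exponentForm μ ≠ 0 := by
  contrapose! hμ
  ext i a
  have := LinearMap.congr_fun hμ (Pi.single i (Pi.single a 1))
  rw [exponentForm_apply] at this
  simpa [Pi.single_apply, apply_ite, ite_apply] using this

/-- over an algebraically closed field of characteristic zero with a
surjective real non-Archimedean valuation (such as the Puiseux series over ℂ), given a
support set I of n+1 exponents in ℤ^k, for every n-tuple of points of ℝ^k outside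
finitely many hyperplanes there is exactly one amoeba with support I through them. -/
theorem amoeba_through_generic_points_exists_unique
    {K : Type*} [Field K] [IsAlgClosed K] [CharZero K] (Val : K → ℝ)
    (hmul : ∀ a b : K, a ≠ 0 → b ≠ 0 → Val (a * b) = Val a + Val b)
    (hadd : ∀ a b : K, a ≠ 0 → b ≠ 0 → a + b ≠ 0 → Val (a + b) ≤ max (Val a) (Val b))
    (hsurj : ∀ r : ℝ, ∃ a : K, a ≠ 0 ∧ Val a = r)
    (k n : ℕ) (hk : 2 ≤ k) (hn : 1 ≤ n)
    (I : Finset (Fin k → ℤ)) (hI : I.card = n + 1) :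
    ∃ L : Finset (((Fin n → Fin k → ℝ) →ₗ[ℝ] ℝ) × ℝ),
      (∀ p ∈ L, p.1 ≠ 0) ∧
      ∀ x : Fin n → Fin k → ℝ, (∀ p ∈ L, p.1 x ≠ p.2) →
        ∃! A : Set (Fin k → ℝ),
          (∃ c : (Fin k → ℤ) → K, (∀ ω ∈ I, c ω ≠ 0) ∧
            A = {v : Fin k → ℝ | ∃ z : Fin k → K, (∀ i, z i ≠ 0) ∧
                  (∑ ω ∈ I, c ω * ∏ i, z i ^ ω i) = 0 ∧ ∀ i, Val (z i) = v i}) ∧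
          ∀ i : Fin n, x i ∈ A := by
  classical
  set v := Valuation.ofReal Val hmul hadd
  have hv : ∀ {a : K}, a ≠ 0 → (v a : ℝ) = Real.exp (Val a) := Valuation.coe_ofReal Val hmul hadd
  have hvVal : ∀ {a b : K}, a ≠ 0 → b ≠ 0 → (v a = v b ↔ Val a = Val b) := fun ha hb => by
    rw [← NNReal.coe_inj, hv ha, hv hb, Real.exp_eq_exp]
  let e₀ : Fin (n + 1) ≃ I := (I.equivFinOfCardEq hI).symm
  let e : Fin (n + 1) → Fin k → ℤ := fun j => e₀ j
  have he : Function.Injective e := Subtype.val_injective.comp e₀.injective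
  have hmem : ∀ j, e j ∈ I := fun j => (e₀ j).2
  have hsum : ∀ F : (Fin k → ℤ) → K, ∑ ω ∈ I, F ω = ∑ j, F (e j) := fun F => by
    rw [← sum_coe_sort, ← e₀.sum_comp]
  refine ⟨(univ : Finset (Fin n → Fin (n + 1))).offDiag.image fun p =>
    (exponentForm fun i => e (p.1 i) - e (p.2 i), 0), ?_, fun x hx => ?_⟩
  · simp only [mem_image, forall_exists_index, and_imp]
    rintro _ ⟨σ, τ⟩ hστ rfl
    refine exponentForm_ne_zero fun h => (mem_offDiag.1 hστ).2.2 <| funext fun i => he ?_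
    exact sub_eq_zero.1 (congrFun h i)
  have hvM : ∀ (z : Fin n → Fin k → K), (∀ i a, z i a ≠ 0) → (∀ i a, Val (z i a) = x i a) →
      ∀ i j, (v (∏ a, z i a ^ e j a) : ℝ) = Real.exp (∑ a, (e j a : ℝ) * x i a) :=
    fun z hz hzx i j => by
      simp [map_prod, hv (hz _ _), hzx, Real.exp_sum, mul_comm _ (x _ _), Real.exp_mul]
  have hMM : ∀ (z y : Fin n → Fin k → K), (∀ i a, z i a ≠ 0) → (∀ i a, Val (z i a) = x i a) →
      (∀ i a, y i a ≠ 0) → (∀ i a, Val (y i a) = x i a) →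
      ∀ i j, v (∏ a, z i a ^ e j a) = v (∏ a, y i a ^ e j a) :=
    fun z y hz hzx hy hyx i j => NNReal.coe_injective (by rw [hvM z hz hzx, hvM y hy hyx])
  have hgen : ∀ (z : Fin n → Fin k → K), (∀ i a, z i a ≠ 0) → (∀ i a, Val (z i a) = x i a) →
      Function.Injective fun σ : Fin n → Fin (n + 1) => ∏ i, v (∏ a, z i a ^ e (σ i) a) :=
    fun z hz hzx σ τ hστ => by
      by_contra hne
      refine hx _ (mem_image_of_mem _ (mem_offDiag (x := (σ, τ)).2 ⟨mem_univ σ, mem_univ τ, hne⟩)) ?_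
      have h := congrArg NNReal.toReal hστ
      simp only [NNReal.coe_prod, hvM z hz hzx, ← Real.exp_sum, Real.exp_eq_exp] at h
      simp only [exponentForm_apply, Pi.sub_apply, Int.cast_sub, sub_mul, sum_sub_distrib, h,
        sub_self]
  have hM0 : ∀ (z : Fin n → Fin k → K), (∀ i a, z i a ≠ 0) → ∀ i j, ∏ a, z i a ^ e j a ≠ 0 :=
    fun z hz i j => prod_ne_zero_iff.2 fun a _ => zpow_ne_zero _ (hz i a)
  choose z hz hzx using fun i a => hsurj (x i a)
  obtain ⟨c, hc, hMc⟩ := exists_mulVec_eq_zero v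
    (M := Matrix.of fun i j => ∏ a, z i a ^ e j a) (hM0 z hz) (hgen z hz hzx)
  let c' : (Fin k → ℤ) → K := Function.extend e c 1
  have hc' : ∀ j, c' (e j) = c j := fun j => he.extend_apply c 1 j
  refine ⟨_, ⟨⟨c', fun ω hω => ?_, rfl⟩, fun i => ⟨z i, hz i, ?_, hzx i⟩⟩, ?_⟩
  · obtain ⟨j, hj⟩ := e₀.surjective ⟨ω, hω⟩
    have hj' : e j = ω := congrArg Subtype.val hj
    rw [← hj', hc']
    exact hc j
  · rw [hsum]
    simpa [Matrix.mulVec, dotProduct, mul_comm, hc'] using congrFun hMc i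
  rintro _ ⟨⟨d, hd, rfl⟩, hdx⟩
  simp only [hsum, hc', Set.mem_ofPred_eq] at hdx ⊢
  choose y hy hyd hyx using hdx
  have hd' : ∀ j, d (e j) ≠ 0 := fun j => hd _ (hmem j)
  have hMd : (Matrix.of fun i j => ∏ a, y i a ^ e j a).mulVec (fun j => d (e j)) = 0 :=
    funext fun i => by simpa [Matrix.mulVec, dotProduct, mul_comm] using hyd i
  have hcd := valuation_eq_mul_of_mulVec_eq_zero v (hM0 z hz) (hMM z y hz hzx hy hyx)
    (hgen z hz hzx) (hc 0) hMc hMd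
  have hdc := valuation_eq_mul_of_mulVec_eq_zero v (hM0 y hy) (hMM y z hy hyx hz hzx)
    (hgen y hy hyx) (hd' 0) hMd hMc
  ext w
  constructor
  · rintro ⟨u, hu, h, huw⟩
    obtain ⟨t, ht, h', htu⟩ := exists_zero_of_valuation_eq_mul v he hd' hc hdc hu h
    exact ⟨t, ht, h', fun a => ((hvVal (ht a) (hu a)).1 (htu a)).trans (huw a)⟩
  · rintro ⟨u, hu, h, huw⟩
    obtain ⟨t, ht, h', htu⟩ := exists_zero_of_valuation_eq_mul v he hc hd' hcd hu h
    exact ⟨t, ht, h', fun a => ((hvVal (ht a) (hu a)).1 (htu a)).trans (huw a)⟩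
end

section
/- If a subdivision S of a convex lattice polygon Δ into convex lattice polygons Δ_1, …, Δ_N consists only of triangles and parallelograms, then the rank of S equals exactly |V(S)| − 1 − Σ_{i=1}^N (|V(Δ_i)| − 3), i.e., the linear conditions imposed by the 4-valent vertices of the dual tropical curve are independent. -/
/-- Embedding of the integer lattice into the real plane. -/
def toR (p : ℤ × ℤ) : ℝ × ℝ := ((p.1 : ℝ), (p.2 : ℝ))

/-- Restriction to a finite point set `S` of the affine function
`(x,y) ↦ p₀ x + p₁ y + p₂`, as a linear map in the parameters `p`. -/
noncomputable def affRestrict (S : Finset (ℝ × ℝ)) : (Fin 3 → ℝ) →ₗ[ℝ] (S → ℝ) where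
  toFun p := fun v => p 0 * (v : ℝ × ℝ).1 + p 1 * (v : ℝ × ℝ).2 + p 2
  map_add' p q := by funext v; simp only [Pi.add_apply]; ring
  map_smul' c p := by funext v; simp only [Pi.smul_apply, smul_eq_mul, RingHom.id_apply]; ring

/-- The subspace of functions `(ℝ×ℝ) → ℝ` whose restriction to `S` agrees with some
affine function. -/
noncomputable def affCompatible (S : Finset (ℝ × ℝ)) : Submodule ℝ ((ℝ × ℝ) → ℝ) :=
  Submodule.comap (LinearMap.funLeft ℝ ℝ (Subtype.val : S → ℝ × ℝ))
    (LinearMap.range (affRestrict S))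

/-- The subspace of functions `(ℝ×ℝ) → ℝ` vanishing outside the finite set `V`. -/
noncomputable def supportedOn (V : Finset (ℝ × ℝ)) : Submodule ℝ ((ℝ × ℝ) → ℝ) :=
  ⨅ (v : ℝ × ℝ) (_ : v ∉ V),
    LinearMap.ker (LinearMap.proj (R := ℝ) (φ := fun _ : ℝ × ℝ => ℝ) v)

/-- The space of vertex-value assignments compatible with a subdivision into the polygons
with vertex sets `P i`: functions supported on the vertex set `V` which are affine on the
vertices of each polygon.  The rank of the subdivision is `finrank` of this space minus
one (the defining convex piecewise-linear function matters up to an additive constant). -/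
noncomputable def subdivisionSpace {N : ℕ} (V : Finset (ℝ × ℝ))
    (P : Fin N → Finset (ℝ × ℝ)) : Submodule ℝ ((ℝ × ℝ) → ℝ) :=
  supportedOn V ⊓ ⨅ i, affCompatible (P i)

/-- The determinant of two plane vectors. -/
def cross (u v : ℝ × ℝ) : ℝ := u.1 * v.2 - u.2 * v.1

lemma exists_smul_of_cross_eq_zero {d z : ℝ × ℝ} (hd : d ≠ 0) (h : cross d z = 0) :
    ∃ t : ℝ, z = t • d := by
  unfold cross at h
  by_cases h1 : d.1 = 0
  · have h2 : d.2 ≠ 0 := fun h2 => hd (Prod.ext h1 h2)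
    refine ⟨z.2 / d.2, Prod.ext ?_ ?_⟩
    · rw [h1] at h
      have : z.1 = 0 := by
        have : d.2 * z.1 = 0 := by linarith
        simpa [h2] using this
      simp [h1, this]
    · simp [h2]
  · refine ⟨z.1 / d.1, Prod.ext ?_ ?_⟩
    · simp [h1]
    · simp only [Prod.smul_snd, smul_eq_mul]
      field_simp
      linarith

lemma collinear_parallelogram_of_cross_eq_zero {v e₁ e₂ : ℝ × ℝ} (h : cross e₁ e₂ = 0) :
    Collinear ℝ ({v, v + e₁, v + e₂, v + e₁ + e₂} : Set (ℝ × ℝ)) := by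
  rw [collinear_iff_of_mem (p₀ := v) (by simp)]
  by_cases h1 : e₁ = 0
  · refine ⟨e₂, ?_⟩
    rintro p (rfl | rfl | rfl | rfl)
    · exact ⟨0, by simp⟩
    · exact ⟨0, by simp [h1]⟩
    · exact ⟨1, by simp [add_comm]⟩
    · exact ⟨1, by simp [h1, add_comm]⟩
  · obtain ⟨t, rfl⟩ := exists_smul_of_cross_eq_zero h1 h
    refine ⟨e₁, ?_⟩
    rintro p (rfl | rfl | rfl | rfl)
    · exact ⟨0, by simp⟩
    · exact ⟨1, by simp [add_comm]⟩
    · exact ⟨t, by simp [add_comm]⟩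
    · exact ⟨1 + t, by simp only [vadd_eq_add]; module⟩

/-- Some translate of `A` by a positive multiple of `d` meets `B`. -/
def Precedes (d : ℝ × ℝ) (A B : Set (ℝ × ℝ)) : Prop :=
  ∃ p ∈ A, ∃ t : ℝ, 0 < t ∧ p + t • d ∈ B

lemma Precedes.asymm {d : ℝ × ℝ} {A B : Set (ℝ × ℝ)} (hA : IsOpen A) (hB : IsOpen B)
    (cA : Convex ℝ A) (cB : Convex ℝ B) (hAB : Disjoint A B)
    (h : Precedes d A B) : ¬ Precedes d B A := by
  rintro ⟨q, hq, s, hs, hqs⟩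
  obtain ⟨p, hp, t, ht, hpt⟩ := h
  obtain ⟨f, u, h1, h2⟩ := geometric_hahn_banach_open_open cA hA cB hB hAB
  have a1 := h1 _ hp
  have a2 := h2 _ hpt
  have a3 := h2 _ hq
  have a4 := h1 _ hqs
  simp only [map_add, map_smul, smul_eq_mul] at a2 a4
  have : 0 < f d := by
    by_contra! hc
    nlinarith
  nlinarith

lemma precedes_or_precedes {d x y : ℝ × ℝ} (hd : d ≠ 0) {A B : Set (ℝ × ℝ)}
    (hAB : Disjoint A B) (hx : x ∈ A) (hy : y ∈ B) (h : cross d x = cross d y) :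
    Precedes d A B ∨ Precedes d B A := by
  obtain ⟨t, ht⟩ := exists_smul_of_cross_eq_zero (d := d) (z := y - x) hd (by
    simp only [cross, Prod.fst_sub, Prod.snd_sub] at h ⊢
    linarith)
  have hyx : y = x + t • d := by rw [← ht]; abel
  rcases lt_trichotomy t 0 with h0 | h0 | h0
  · exact Or.inr ⟨y, hy, -t, by linarith, by
      have : y + -t • d = x := by rw [hyx]; module
      rwa [this]⟩
  · exact (Set.disjoint_left.1 hAB hx (by
      have : y = x := by rw [hyx, h0]; module
      rwa [← this])).elim
  · exact Or.inl ⟨x, hx, t, h0, hyx ▸ hy⟩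

/-- Points of three disjoint convex sets on a common line of direction `d` are ordered
transitively. -/
lemma Precedes.trans_of_common_line {d x y z : ℝ × ℝ} (hd : d ≠ 0) {A B C : Set (ℝ × ℝ)}
    (oA : IsOpen A) (oB : IsOpen B) (oC : IsOpen C)
    (cA : Convex ℝ A) (cB : Convex ℝ B) (cC : Convex ℝ C)
    (hAB : Disjoint A B) (hBC : Disjoint B C)
    (h1 : Precedes d A B) (h2 : Precedes d B C)
    (hx : x ∈ A) (hy : y ∈ B) (hz : z ∈ C)
    (hxy : cross d x = cross d y) (hyz : cross d y = cross d z) : Precedes d A C := by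
  have key : ∀ {x y : ℝ × ℝ} {A B : Set (ℝ × ℝ)}, IsOpen A → IsOpen B → Convex ℝ A →
      Convex ℝ B → Disjoint A B → Precedes d A B → x ∈ A → y ∈ B → cross d x = cross d y →
      ∃ t : ℝ, 0 < t ∧ y = x + t • d := by
    intro x y A B oA oB cA cB hAB h hx hy hxy
    have hxy' : Disjoint ({x} : Set (ℝ × ℝ)) {y} :=
      Set.disjoint_singleton.2 fun e => Set.disjoint_left.1 hAB hx (e ▸ hy)
    rcases precedes_or_precedes hd hxy' rfl rfl hxy with ⟨p, rfl, t, ht, e⟩ | ⟨p, rfl, t, ht, e⟩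
    · exact ⟨t, ht, e.symm⟩
    · exact (h.asymm oA oB cA cB hAB ⟨_, hy, t, ht, by rw [Set.mem_singleton_iff.1 e]; exact hx⟩).elim
  obtain ⟨t, ht, rfl⟩ := key oA oB cA cB hAB h1 hx hy hxy
  obtain ⟨s, hs, rfl⟩ := key oB oC cB cC hBC h2 hy hz hyz
  exact ⟨x, hx, t + s, by positivity, by rwa [add_smul, ← add_assoc]⟩

/-- The linear functional `cross d`. -/
noncomputable def crossCLM (d : ℝ × ℝ) : (ℝ × ℝ) →L[ℝ] ℝ :=
  d.1 • ContinuousLinearMap.snd ℝ ℝ ℝ - d.2 • ContinuousLinearMap.fst ℝ ℝ ℝ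

lemma crossCLM_apply (d x : ℝ × ℝ) : crossCLM d x = cross d x := by
  simp [crossCLM, cross]

lemma crossCLM_surjective {d : ℝ × ℝ} (hd : d ≠ 0) : Function.Surjective (crossCLM d) := by
  refine LinearMap.surjective (f := (crossCLM d).toLinearMap) fun h => hd ?_
  have h1 := LinearMap.congr_fun h (1, 0)
  have h2 := LinearMap.congr_fun h (0, 1)
  simp [crossCLM] at h1 h2
  exact Prod.ext h2 h1

/-- Among finitely many disjoint bounded open convex plane sets, one can be moved away in a given
direction without meeting the others. -/
lemma exists_not_precedes {ι : Type*} {d : ℝ × ℝ} (hd : d ≠ 0) (U : ι → Set (ℝ × ℝ))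
    (hopen : ∀ i, IsOpen (U i)) (hconv : ∀ i, Convex ℝ (U i))
    (hbdd : ∀ i, Bornology.IsBounded (U i)) (hdisj : ∀ i j, i ≠ j → Disjoint (U i) (U j))
    (s : Finset ι) (hs : s.Nonempty) :
    ∃ m ∈ s, ∀ j ∈ s, j ≠ m → ¬ Precedes d (U m) (U j) := by
  classical
  induction s using Finset.strongInduction with
  | H s ih =>
  obtain ⟨T, hT, hTmin⟩ := Finset.exists_min_image s (fun i => sSup (crossCLM d '' U i)) hs
  by_cases hmax : ∀ j ∈ s, j ≠ T → ¬ Precedes d (U T) (U j)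
  · exact ⟨T, hT, hmax⟩
  push Not at hmax
  obtain ⟨T', hT', hne, hTT'⟩ := hmax
  obtain ⟨M, hM, hMmax⟩ := ih (s.erase T) (Finset.erase_ssubset hT)
    ⟨T', Finset.mem_erase.2 ⟨hne, hT'⟩⟩
  obtain ⟨hMT, hMs⟩ := Finset.mem_erase.1 hM
  refine ⟨M, hMs, fun j hj hjM => ?_⟩
  by_cases hjT : j = T
  swap
  · exact hMmax j (Finset.mem_erase.2 ⟨hjT, hj⟩) hjM
  subst hjT
  intro hMj
  have bdd : ∀ i, BddAbove (crossCLM d '' U i) := fun i =>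
    ((crossCLM d).lipschitz.isBounded_image (hbdd i)).bddAbove
  have cross_add : ∀ (p : ℝ × ℝ) (t : ℝ), crossCLM d (p + t • d) = crossCLM d p := by
    intro p t
    simp only [crossCLM_apply, cross, Prod.fst_add, Prod.snd_add, Prod.smul_fst, Prod.smul_snd,
      smul_eq_mul]
    ring
  have extend : ∀ i ∈ s, ∀ x ∈ crossCLM d '' U i, ∀ y ∈ crossCLM d '' U j, x ≤ y →
      y ∈ crossCLM d '' U i := by
    intro i hi x hx y hy hxy
    have hlt : y < sSup (crossCLM d '' U j) := by
      have ho : IsOpen (crossCLM d '' U j) :=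
        (crossCLM d).isOpenMap (crossCLM_surjective hd) _ (hopen j)
      obtain ⟨z, hz, hz'⟩ := (ho.eventually_mem hy |>.filter_mono nhdsWithin_le_nhds |>.and
        (self_mem_nhdsWithin (s := Set.Ioi y))).exists
      exact lt_of_lt_of_le hz' (le_csSup (bdd j) hz)
    obtain ⟨z, hz, hyz⟩ := exists_lt_of_lt_csSup ⟨x, hx⟩ (hlt.trans_le (hTmin i hi))
    have hc : Convex ℝ (crossCLM d '' U i) := (hconv i).linear_image (crossCLM d).toLinearMap
    exact hc.ordConnected.out hx hz ⟨hxy, hyz.le⟩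
  have hx1 : ∃ x, x ∈ crossCLM d '' U M ∧ x ∈ crossCLM d '' U j := by
    obtain ⟨p, hp, t, _, hpt⟩ := hMj
    exact ⟨_, ⟨p, hp, rfl⟩, ⟨_, hpt, cross_add p t⟩⟩
  have hx2 : ∃ x, x ∈ crossCLM d '' U T' ∧ x ∈ crossCLM d '' U j := by
    obtain ⟨p, hp, t, _, hpt⟩ := hTT'
    exact ⟨_, ⟨_, hpt, cross_add p t⟩, ⟨p, hp, rfl⟩⟩
  obtain ⟨x1, hx1M, hx1j⟩ := hx1
  obtain ⟨x2, hx2T, hx2j⟩ := hx2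
  have hall : ∃ x, x ∈ crossCLM d '' U M ∧ x ∈ crossCLM d '' U j ∧ x ∈ crossCLM d '' U T' := by
    rcases le_total x1 x2 with h | h
    · exact ⟨x2, extend M hMs _ hx1M _ hx2j h, hx2j, hx2T⟩
    · exact ⟨x1, hx1M, hx1j, extend T' hT' _ hx2T _ hx1j h⟩
  obtain ⟨_, ⟨a, ha, rfl⟩, ⟨b, hb, hba⟩, ⟨c, hc, hca⟩⟩ := hall
  simp only [crossCLM_apply] at hba hca
  have hMT' : Precedes d (U M) (U T') :=
    hMj.trans_of_common_line hd (hopen _) (hopen _) (hopen _) (hconv _) (hconv _) (hconv _)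
      (hdisj _ _ hMT) (hdisj _ _ hne.symm) hTT' ha hb hc hba.symm (hba.trans hca.symm)
  by_cases hT'M : T' = M
  · subst hT'M
    exact hMj.asymm (hopen _) (hopen _) (hconv _) (hconv _) (hdisj _ _ hMT) hTT'
  · exact hMmax T' (Finset.mem_erase.2 ⟨hne, hT'⟩) hT'M hMT'

lemma eq_add_smul_add_smul {e₁ e₂ : ℝ × ℝ} (hD : cross e₁ e₂ ≠ 0) (x : ℝ × ℝ) :
    x = (cross x e₂ / cross e₁ e₂) • e₁ + (cross e₁ x / cross e₁ e₂) • e₂ := by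
  apply Prod.ext <;>
    simp only [Prod.fst_add, Prod.snd_add, Prod.smul_fst, Prod.smul_snd, smul_eq_mul] <;>
    field_simp <;> simp only [cross] <;> ring

lemma mem_convexHull_parallelogram {v e₁ e₂ : ℝ × ℝ} {a b : ℝ} (ha : a ∈ Set.Icc (0 : ℝ) 1)
    (hb : b ∈ Set.Icc (0 : ℝ) 1) :
    v + a • e₁ + b • e₂ ∈ convexHull ℝ ({v, v + e₁, v + e₂, v + e₁ + e₂} : Set (ℝ × ℝ)) := by
  set S : Set (ℝ × ℝ) := {v, v + e₁, v + e₂, v + e₁ + e₂} with hS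
  have hc := convex_convexHull ℝ S
  have mem : ∀ p ∈ S, p ∈ convexHull ℝ S := fun p hp => subset_convexHull ℝ S hp
  have h1 : v + a • e₁ ∈ convexHull ℝ S := by
    have := hc (mem v (by simp [hS])) (mem (v + e₁) (by simp [hS])) (sub_nonneg.2 ha.2) ha.1
      (by ring)
    convert this using 1
    module
  have h2 : v + e₂ + a • e₁ ∈ convexHull ℝ S := by
    have := hc (mem (v + e₂) (by simp [hS])) (mem (v + e₁ + e₂) (by simp [hS]))
      (sub_nonneg.2 ha.2) ha.1 (by ring)
    convert this using 1
    module
  have := hc h1 h2 (sub_nonneg.2 hb.2) hb.1 (by ring)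
  convert this using 1
  module

lemma mem_interior_convexHull_parallelogram {v e₁ e₂ : ℝ × ℝ} (hD : cross e₁ e₂ ≠ 0) {a b : ℝ}
    (ha : a ∈ Set.Ioo (0 : ℝ) 1) (hb : b ∈ Set.Ioo (0 : ℝ) 1) :
    v + a • e₁ + b • e₂ ∈
      interior (convexHull ℝ ({v, v + e₁, v + e₂, v + e₁ + e₂} : Set (ℝ × ℝ))) := by
  let O : Set (ℝ × ℝ) := {p | cross (p - v) e₂ / cross e₁ e₂ ∈ Set.Ioo (0 : ℝ) 1} ∩
    {p | cross e₁ (p - v) / cross e₁ e₂ ∈ Set.Ioo (0 : ℝ) 1}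
  have hO : IsOpen O := by
    refine (isOpen_Ioo.preimage ?_).inter (isOpen_Ioo.preimage ?_) <;>
    · unfold cross
      fun_prop
  refine interior_maximal (fun p hp => ?_) hO ⟨?_, ?_⟩
  · have := mem_convexHull_parallelogram (v := v) (e₁ := e₁) (e₂ := e₂)
      (Set.Ioo_subset_Icc_self hp.1) (Set.Ioo_subset_Icc_self hp.2)
    rwa [add_assoc v (_ • e₁), ← eq_add_smul_add_smul hD, add_sub_cancel] at this
  · have : cross (v + a • e₁ + b • e₂ - v) e₂ / cross e₁ e₂ = a := by
      rw [div_eq_iff hD]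
      simp [cross]
      ring
    rw [Set.mem_ofPred_eq, this]
    exact ha
  · have : cross e₁ (v + a • e₁ + b • e₂ - v) / cross e₁ e₂ = b := by
      rw [div_eq_iff hD]
      simp [cross]
      ring
    rw [Set.mem_ofPred_eq, this]
    exact hb

/-- The parallelogram with vertex `v` and edges `e₁`, `e₂` precedes every convex body through
its last vertex in a direction pointing into the cone spanned by `e₁` and `e₂`. -/
lemma precedes_of_last_vertex_mem {d v e₁ e₂ : ℝ × ℝ} {s t : ℝ} (hD : cross e₁ e₂ ≠ 0)
    (hs : 0 < s) (ht : 0 < t) (hd : d = s • e₁ + t • e₂) {K : Set (ℝ × ℝ)} (cK : Convex ℝ K)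
    (hK : (interior K).Nonempty) (hw : v + e₁ + e₂ ∈ K) :
    Precedes d
      (interior (convexHull ℝ ({v, v + e₁, v + e₂, v + e₁ + e₂} : Set (ℝ × ℝ)))) (interior K) := by
  set T := interior (convexHull ℝ ({v, v + e₁, v + e₂, v + e₁ + e₂} : Set (ℝ × ℝ))) with hT
  set ε : ℝ := 1 / (1 + s + t) with hε
  have hε0 : 0 < ε := by positivity
  have hεs : ε * s < 1 := by
    rw [hε, div_mul_eq_mul_div, div_lt_one (by positivity)]
    linarith
  have hεt : ε * t < 1 := by
    rw [hε, div_mul_eq_mul_div, div_lt_one (by positivity)]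
    linarith
  have hwT : v + e₁ + e₂ - ε • d ∈ T := by
    have := mem_interior_convexHull_parallelogram (v := v) hD (a := 1 - ε * s) (b := 1 - ε * t)
      ⟨by linarith, by nlinarith⟩ ⟨by linarith, by nlinarith⟩
    convert this using 1
    rw [hd]
    module
  have hopen : IsOpen ((fun p => p - ε • d) ⁻¹' T) :=
    isOpen_interior.preimage (by fun_prop)
  have hcl : v + e₁ + e₂ ∈ closure (interior K) := by
    rw [cK.closure_interior_eq_closure_of_nonempty_interior hK]
    exact subset_closure hw
  obtain ⟨u, hu1, hu2⟩ := mem_closure_iff.1 hcl _ hopen hwT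
  exact ⟨u - ε • d, hu1, ε, hε0, by rwa [sub_add_cancel]⟩

/-- A parallelogram can be presented with edges whose open cone contains a given direction not
parallel to an edge. -/
lemma exists_positive_presentation {d v e₁ e₂ : ℝ × ℝ} (hD : cross e₁ e₂ ≠ 0)
    (h₁ : cross d e₁ ≠ 0) (h₂ : cross d e₂ ≠ 0) :
    ∃ (w f₁ f₂ : ℝ × ℝ) (s t : ℝ), cross f₁ f₂ ≠ 0 ∧ 0 < s ∧ 0 < t ∧ d = s • f₁ + t • f₂ ∧
      ({v, v + e₁, v + e₂, v + e₁ + e₂} : Finset (ℝ × ℝ)) =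
        {w, w + f₁, w + f₂, w + f₁ + f₂} := by
  have hd := eq_add_smul_add_smul hD d
  set s := cross d e₂ / cross e₁ e₂ with hs
  set t := cross e₁ d / cross e₁ e₂ with ht
  have hs0 : s ≠ 0 := div_ne_zero h₂ hD
  have ht0 : t ≠ 0 := div_ne_zero (fun h => h₁ (by unfold cross at *; linarith)) hD
  have hn1 : cross (-e₁) e₂ ≠ 0 := fun h => hD (by simp [cross] at *; linarith)
  have hn2 : cross e₁ (-e₂) ≠ 0 := fun h => hD (by simp [cross] at *; linarith)
  have hn3 : cross (-e₁) (-e₂) ≠ 0 := fun h => hD (by simp [cross] at *; linarith)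
  rcases lt_or_gt_of_ne hs0 with hs' | hs' <;> rcases lt_or_gt_of_ne ht0 with ht' | ht'
  · refine ⟨v + e₁ + e₂, -e₁, -e₂, -s, -t, hn3, by linarith, by linarith, ?_, ?_⟩
    · rw [hd]; module
    · have h1 : v + e₁ + e₂ + -e₁ = v + e₂ := by module
      have h2 : v + e₁ + e₂ + -e₂ = v + e₁ := by module
      have h3 : v + e₂ + -e₂ = v := by module
      rw [h1, h2, h3]
      ext p; simp only [Finset.mem_insert, Finset.mem_singleton]; tauto
  · refine ⟨v + e₁, -e₁, e₂, -s, t, hn1, by linarith, by linarith, ?_, ?_⟩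
    · rw [hd]; module
    · have h1 : v + e₁ + -e₁ = v := by module
      rw [h1]
      ext p; simp only [Finset.mem_insert, Finset.mem_singleton]; tauto
  · refine ⟨v + e₂, e₁, -e₂, s, -t, hn2, by linarith, by linarith, ?_, ?_⟩
    · rw [hd]; module
    · have h1 : v + e₂ + e₁ = v + e₁ + e₂ := by module
      have h2 : v + e₂ + -e₂ = v := by module
      have h3 : v + e₁ + e₂ + -e₂ = v + e₁ := by module
      rw [h1, h2, h3]
      ext p; simp only [Finset.mem_insert, Finset.mem_singleton]; tauto
  · exact ⟨v, e₁, e₂, s, t, hD, hs', ht', hd, rfl⟩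

lemma cross_one_sqrt_two_ne_zero {p : ℤ × ℤ} (hp : p ≠ 0) :
    cross (1, Real.sqrt 2) (toR p) ≠ 0 := by
  intro h
  simp only [cross, toR, one_mul] at h
  by_cases h1 : p.1 = 0
  · rw [h1] at h
    refine hp (Prod.ext h1 ?_)
    simpa using h
  · refine (irrational_sqrt_two.mul_intCast h1) ⟨(p.2 : ℚ), ?_⟩
    push_cast
    linarith

lemma toR_sub (p q : ℤ × ℤ) : toR (p - q) = toR p - toR q := by
  simp [toR]

lemma mem_affCompatible {S : Finset (ℝ × ℝ)} {f : ℝ × ℝ → ℝ} :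
    f ∈ affCompatible S ↔ ∃ p : Fin 3 → ℝ, ∀ v ∈ S, p 0 * v.1 + p 1 * v.2 + p 2 = f v := by
  simp only [affCompatible, Submodule.mem_comap, LinearMap.mem_range]
  refine exists_congr fun p => ?_
  rw [funext_iff, Subtype.forall]
  rfl

lemma exists_affine_interpolation {e₁ e₂ : ℝ × ℝ} (hD : cross e₁ e₂ ≠ 0) (v : ℝ × ℝ)
    (a b c : ℝ) : ∃ p : Fin 3 → ℝ, p 0 * v.1 + p 1 * v.2 + p 2 = a ∧
      p 0 * (v + e₁).1 + p 1 * (v + e₁).2 + p 2 = b ∧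
      p 0 * (v + e₂).1 + p 1 * (v + e₂).2 + p 2 = c := by
  set x := ((b - a) * e₂.2 - (c - a) * e₁.2) / cross e₁ e₂ with hx
  set y := ((c - a) * e₁.1 - (b - a) * e₂.1) / cross e₁ e₂ with hy
  have h1 : x * e₁.1 + y * e₁.2 = b - a := by
    rw [hx, hy]; field_simp; unfold cross; ring
  have h2 : x * e₂.1 + y * e₂.2 = c - a := by
    rw [hx, hy]; field_simp; unfold cross; ring
  refine ⟨![x, y, a - x * v.1 - y * v.2], ?_, ?_, ?_⟩ <;> simp <;> linarith

lemma affCompatible_eq_top {S : Finset (ℝ × ℝ)} (hcard : S.card = 3)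
    (hS : ¬ Collinear ℝ (S : Set (ℝ × ℝ))) : affCompatible S = ⊤ := by
  obtain ⟨x, y, z, -, -, -, rfl⟩ := Finset.card_eq_three.1 hcard
  have hD : cross (y - x) (z - x) ≠ 0 := fun h =>
    hS ((collinear_parallelogram_of_cross_eq_zero (v := x) h).subset (by
      intro p hp
      simp at hp ⊢
      tauto))
  rw [eq_top_iff]
  intro f _
  obtain ⟨p, h0, h1, h2⟩ := exists_affine_interpolation hD x (f x) (f y) (f z)
  rw [add_sub_cancel] at h1 h2
  refine mem_affCompatible.2 ⟨p, fun v hv => ?_⟩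
  simp only [Finset.mem_insert, Finset.mem_singleton] at hv
  rcases hv with rfl | rfl | rfl <;> assumption

/-- The alternating sum of the values of a function at the vertices of a parallelogram. -/
def altSum (v e₁ e₂ : ℝ × ℝ) : (ℝ × ℝ → ℝ) →ₗ[ℝ] ℝ :=
  LinearMap.proj (R := ℝ) (φ := fun _ => ℝ) v - LinearMap.proj (φ := fun _ => ℝ) (v + e₁) -
    LinearMap.proj (φ := fun _ => ℝ) (v + e₂) + LinearMap.proj (φ := fun _ => ℝ) (v + e₁ + e₂)

lemma altSum_apply (v e₁ e₂ : ℝ × ℝ) (f : ℝ × ℝ → ℝ) :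
    altSum v e₁ e₂ f = f v - f (v + e₁) - f (v + e₂) + f (v + e₁ + e₂) := rfl

lemma mem_affCompatible_parallelogram {v e₁ e₂ : ℝ × ℝ} (hD : cross e₁ e₂ ≠ 0)
    {f : ℝ × ℝ → ℝ} :
    f ∈ affCompatible {v, v + e₁, v + e₂, v + e₁ + e₂} ↔ altSum v e₁ e₂ f = 0 := by
  rw [mem_affCompatible, altSum_apply]
  constructor
  · rintro ⟨p, hp⟩
    rw [← hp v (by simp), ← hp (v + e₁) (by simp), ← hp (v + e₂) (by simp),
      ← hp (v + e₁ + e₂) (by simp)]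
    simp only [Prod.fst_add, Prod.snd_add]
    ring
  · intro h
    obtain ⟨p, h0, h1, h2⟩ := exists_affine_interpolation hD v (f v) (f (v + e₁)) (f (v + e₂))
    refine ⟨p, fun w hw => ?_⟩
    simp only [Finset.mem_insert, Finset.mem_singleton] at hw
    rcases hw with rfl | rfl | rfl | rfl
    · exact h0
    · exact h1
    · exact h2
    · simp only [Prod.fst_add, Prod.snd_add] at h1 h2 ⊢
      linarith

lemma mem_supportedOn {V : Finset (ℝ × ℝ)} {f : ℝ × ℝ → ℝ} :
    f ∈ supportedOn V ↔ ∀ v ∉ V, f v = 0 := by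
  simp [supportedOn, Submodule.mem_iInf]

/-- Functions supported on `V` are the same as functions on `V`. -/
noncomputable def supportedOnEquiv (V : Finset (ℝ × ℝ)) : supportedOn V ≃ₗ[ℝ] (V → ℝ) :=
  LinearEquiv.ofBijective
    ((LinearMap.funLeft ℝ ℝ (Subtype.val : V → ℝ × ℝ)).comp (supportedOn V).subtype) <| by
    classical
    constructor
    · intro f g h
      ext v
      by_cases hv : v ∈ V
      · exact congrFun h ⟨v, hv⟩
      · rw [mem_supportedOn.1 f.2 v hv, mem_supportedOn.1 g.2 v hv]
    · intro g
      refine ⟨⟨fun v => if hv : v ∈ V then g ⟨v, hv⟩ else 0,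
        mem_supportedOn.2 fun v hv => dif_neg hv⟩, ?_⟩
      ext v
      simp [LinearMap.funLeft_apply]

/-- Linear forms are jointly surjective on a subspace if every nonempty set of indices contains
one whose form is separated from the others of the set by an element of the subspace. -/
lemma pi_domRestrict_surjective {ι E : Type*} [Fintype ι] [AddCommGroup E] [Module ℝ E]
    (W : Submodule ℝ E) (L : ι → E →ₗ[ℝ] ℝ)
    (h : ∀ s : Finset ι, s.Nonempty → ∃ m ∈ s, ∃ g ∈ W, L m g ≠ 0 ∧
      ∀ j ∈ s, j ≠ m → L j g = 0) :
    Function.Surjective ((LinearMap.pi L).domRestrict W) := by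
  classical
  rw [← LinearMap.range_eq_top]
  by_contra hne
  obtain ⟨φ, hφ, hle⟩ := Submodule.exists_le_ker_of_lt_top _ (lt_top_iff_ne_top.2 hne)
  have hφsum : ∀ x : ι → ℝ, φ x = ∑ i, x i * φ (Pi.single i 1) := by
    intro x
    conv_lhs => rw [pi_eq_sum_univ' x]
    simp [map_sum]
  obtain ⟨m, hm, g, hg, hmg, hj⟩ := h (Finset.univ.filter fun i => φ (Pi.single i 1) ≠ 0) (by
    by_contra hemp
    rw [Finset.not_nonempty_iff_eq_empty, Finset.filter_eq_empty_iff] at hemp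
    refine hφ (LinearMap.ext fun x => ?_)
    rw [hφsum]
    exact Finset.sum_eq_zero fun i hi => by simp [not_not.1 (hemp hi)])
  have h0 : φ (fun i => L i g) = 0 := hle ⟨⟨g, hg⟩, rfl⟩
  rw [hφsum, Finset.sum_eq_single m ?_ (by simp)] at h0
  · exact mul_ne_zero hmg (Finset.mem_filter.1 hm).2 h0
  · intro j _ hjm
    by_cases hjs : φ (Pi.single j 1) = 0
    · simp [hjs]
    · rw [hj j (by simpa using hjs) hjm, zero_mul]

lemma cross_ne_zero_of_not_collinear {v e₁ e₂ : ℝ × ℝ}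
    (h : ¬ Collinear ℝ (({v, v + e₁, v + e₂, v + e₁ + e₂} : Finset (ℝ × ℝ)) : Set (ℝ × ℝ))) :
    cross e₁ e₂ ≠ 0 := fun h0 =>
  h (by simpa using collinear_parallelogram_of_cross_eq_zero (v := v) h0)

lemma cross_one_sqrt_two_edge_ne_zero {S : Finset (ℝ × ℝ)}
    (hlat : ∀ v ∈ S, ∃ p : ℤ × ℤ, v = toR p) {v e : ℝ × ℝ} (hv : v ∈ S) (he : v + e ∈ S)
    (h0 : e ≠ 0) : cross (1, Real.sqrt 2) e ≠ 0 := by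
  obtain ⟨p, hp⟩ := hlat _ hv
  obtain ⟨q, hq⟩ := hlat _ he
  have h : e = toR (q - p) := by rw [toR_sub, ← hp, ← hq, add_sub_cancel_left]
  rw [h]
  refine cross_one_sqrt_two_ne_zero fun h1 => h0 ?_
  rw [h, h1]
  simp [toR]

lemma altSum_single_last {v e₁ e₂ : ℝ × ℝ} (hD : cross e₁ e₂ ≠ 0) :
    altSum v e₁ e₂ (Pi.single (v + e₁ + e₂) 1) = 1 := by
  classical
  have h1 : e₁ ≠ 0 := by rintro rfl; simp [cross] at hD
  have h2 : e₂ ≠ 0 := by rintro rfl; simp [cross] at hD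
  have h3 : v ≠ v + e₁ + e₂ := fun h => hD (by
    have : e₂ = -e₁ := by
      rw [add_assoc, left_eq_add] at h
      exact (neg_eq_of_add_eq_zero_right h).symm
    rw [this]
    simp [cross]
    ring)
  have h4 : v + e₁ ≠ v + e₁ + e₂ := by simpa using h2
  have h5 : v + e₂ ≠ v + e₁ + e₂ := by
    rw [add_right_comm]
    simpa using h1
  rw [altSum_apply, Pi.single_eq_of_ne h3, Pi.single_eq_of_ne h4, Pi.single_eq_of_ne h5,
    Pi.single_eq_same]
  norm_num

/-- The parallelogram relations are independent on any set of points containing the vertices. -/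
lemma altSum_surjective {ι : Type*} [Fintype ι] {d : ℝ × ℝ} (hd0 : d ≠ 0)
    (V : Finset (ℝ × ℝ)) (v e₁ e₂ : ι → ℝ × ℝ) (s t : ι → ℝ)
    (hV : ∀ i, v i + e₁ i + e₂ i ∈ V) (hD : ∀ i, cross (e₁ i) (e₂ i) ≠ 0)
    (hs : ∀ i, 0 < s i) (ht : ∀ i, 0 < t i) (hd : ∀ i, d = s i • e₁ i + t i • e₂ i)
    (hdisj : ∀ i j, i ≠ j → Disjoint
      (interior (convexHull ℝ
        ({v i, v i + e₁ i, v i + e₂ i, v i + e₁ i + e₂ i} : Set (ℝ × ℝ))))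
      (interior (convexHull ℝ
        ({v j, v j + e₁ j, v j + e₂ j, v j + e₁ j + e₂ j} : Set (ℝ × ℝ))))) :
    Function.Surjective
      ((LinearMap.pi fun i => altSum (v i) (e₁ i) (e₂ i)).domRestrict (supportedOn V)) := by
  classical
  refine pi_domRestrict_surjective _ _ fun S hS => ?_
  obtain ⟨m, hm, hmax⟩ := exists_not_precedes hd0 _ (fun _ => isOpen_interior)
    (fun i => (convex_convexHull ℝ _).interior)
    (fun i => (isBounded_convexHull.2 (Set.toFinite
      ({v i, v i + e₁ i, v i + e₂ i, v i + e₁ i + e₂ i} : Set (ℝ × ℝ))).isBounded).subset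
        interior_subset) hdisj S hS
  refine ⟨m, hm, Pi.single (v m + e₁ m + e₂ m) 1, mem_supportedOn.2 fun w hw => ?_, ?_, ?_⟩
  · exact Pi.single_eq_of_ne (by rintro rfl; exact hw (hV m)) _
  · rw [altSum_single_last (hD m)]
    exact one_ne_zero
  · intro j hj hjm
    have hnot : v m + e₁ m + e₂ m ∉
        ({v j, v j + e₁ j, v j + e₂ j, v j + e₁ j + e₂ j} : Set (ℝ × ℝ)) := fun hmem =>
      hmax j hj hjm (precedes_of_last_vertex_mem (hD m) (hs m) (ht m) (hd m)
        (convex_convexHull ℝ _)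
        ⟨_, mem_interior_convexHull_parallelogram (a := 1 / 2) (b := 1 / 2) (hD j)
          (by norm_num) (by norm_num)⟩ (subset_convexHull ℝ _ hmem))
    simp only [Set.mem_insert_iff, Set.mem_singleton_iff, not_or] at hnot
    rw [altSum_apply, Pi.single_eq_of_ne' hnot.1, Pi.single_eq_of_ne' hnot.2.1,
      Pi.single_eq_of_ne' hnot.2.2.1, Pi.single_eq_of_ne' hnot.2.2.2]
    norm_num

/-- if a subdivision of a convex lattice polygon induced by a convex
piecewise-linear function consists only of triangles and parallelograms, then its rank
equals exactly |V(S)| − 1 − Σᵢ (|V(Δᵢ)| − 3). -/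
theorem rank_equality_for_nodal_subdivision
    (N : ℕ) (hN : 0 < N) (P : Fin N → Finset (ℝ × ℝ)) (V : Finset (ℝ × ℝ))
    (hV : ∀ v : ℝ × ℝ, v ∈ V ↔ ∃ i, v ∈ P i)
    (hlat : ∀ i, ∀ v ∈ P i, ∃ p : ℤ × ℤ, v = toR p)
    (hnondeg : ∀ i, ¬ Collinear ℝ ((P i : Set (ℝ × ℝ))))
    (hvert : ∀ i, ∀ v ∈ P i, v ∈ Set.extremePoints ℝ (convexHull ℝ (P i : Set (ℝ × ℝ))))
    (hdisj : ∀ i j, i ≠ j →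
      interior (convexHull ℝ (P i : Set (ℝ × ℝ))) ∩
        interior (convexHull ℝ (P j : Set (ℝ × ℝ))) = ∅)
    (hconv : ∃ ν : ℝ × ℝ → ℝ,
      ConvexOn ℝ (convexHull ℝ (⋃ i, (P i : Set (ℝ × ℝ)))) ν ∧
      ∀ i, ∃ a : (ℝ × ℝ) →ᵃ[ℝ] ℝ, Set.EqOn ν a (convexHull ℝ (P i : Set (ℝ × ℝ))))
    (hshape : ∀ i, (P i).card = 3 ∨
      ∃ v0 e1 e2 : ℝ × ℝ, (P i) = ({v0, v0 + e1, v0 + e2, v0 + e1 + e2} : Finset (ℝ × ℝ)) ∧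
        (P i).card = 4) :
    (Module.finrank ℝ (subdivisionSpace V P) : ℤ) - 1
      = (V.card : ℤ) - 1 - ∑ i, ((P i).card - 3 : ℤ) := by
  classical
  have hd0 : ((1, Real.sqrt 2) : ℝ × ℝ) ≠ 0 := fun h => by simpa using congrArg Prod.fst h
  have hpres : ∀ i : {i // (P i).card = 4}, ∃ (w f₁ f₂ : ℝ × ℝ) (s t : ℝ),
      cross f₁ f₂ ≠ 0 ∧ 0 < s ∧ 0 < t ∧ ((1, Real.sqrt 2) : ℝ × ℝ) = s • f₁ + t • f₂ ∧
        P i = {w, w + f₁, w + f₂, w + f₁ + f₂} := by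
    rintro ⟨i, hi⟩
    obtain h | ⟨v, e₁, e₂, hP, -⟩ := hshape i
    · omega
    have hD : cross e₁ e₂ ≠ 0 := cross_ne_zero_of_not_collinear (hP ▸ hnondeg i)
    have hv : v ∈ P i := by simp [hP]
    obtain ⟨w, f₁, f₂, s, t, h⟩ := exists_positive_presentation (v := v) hD
      (cross_one_sqrt_two_edge_ne_zero (hlat i) hv (by simp [hP])
        (by rintro rfl; simp [cross] at hD))
      (cross_one_sqrt_two_edge_ne_zero (hlat i) hv (by simp [hP])
        (by rintro rfl; simp [cross] at hD))
    exact ⟨w, f₁, f₂, s, t, h.1, h.2.1, h.2.2.1, h.2.2.2.1, hP.trans h.2.2.2.2⟩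
  choose v e₁ e₂ s t hD hs ht hd hP using hpres
  have hPset : ∀ i : {i // (P i).card = 4}, (P i : Set (ℝ × ℝ)) =
      {v i, v i + e₁ i, v i + e₂ i, v i + e₁ i + e₂ i} := fun i => by rw [hP i]; simp
  have hsurj := altSum_surjective hd0 V v e₁ e₂ s t
    (fun i => (hV _).2 ⟨i, by rw [hP i]; simp⟩) hD hs ht hd (fun i j hij => by
      rw [← hPset, ← hPset, Set.disjoint_iff_inter_eq_empty]
      exact hdisj i j fun h => hij (Subtype.ext h))
  set Φ := LinearMap.pi fun i => altSum (v i) (e₁ i) (e₂ i) with hΦ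
  have hspace : subdivisionSpace V P = supportedOn V ⊓ LinearMap.ker Φ := by
    ext f
    simp only [subdivisionSpace, Submodule.mem_inf, Submodule.mem_iInf, LinearMap.mem_ker]
    refine and_congr_right fun _ => ⟨fun h => ?_, fun h i => ?_⟩
    · funext i
      have := h i
      rw [hP i] at this
      exact (mem_affCompatible_parallelogram (hD i)).1 this
    · obtain h3 | ⟨_, _, _, -, h4⟩ := hshape i
      · rw [affCompatible_eq_top h3 (hnondeg i)]
        trivial
      · rw [hP ⟨i, h4⟩, mem_affCompatible_parallelogram (hD ⟨i, h4⟩)]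
        exact congrFun h ⟨i, h4⟩
  have : FiniteDimensional ℝ (supportedOn V) := (supportedOnEquiv V).symm.finiteDimensional
  have hrank := (Φ.domRestrict (supportedOn V)).finrank_range_add_finrank_ker
  have hker : Module.finrank ℝ (LinearMap.ker (Φ.domRestrict (supportedOn V))) =
      Module.finrank ℝ (subdivisionSpace V P) := by
    rw [hspace, LinearMap.ker_domRestrict, ← Submodule.map_comap_subtype]
    exact (Submodule.finrank_map_subtype_eq _ _).symm
  rw [LinearMap.range_eq_top.2 hsurj, finrank_top, hker, (supportedOnEquiv V).finrank_eq,
    Module.finrank_fintype_fun_eq_card, Module.finrank_fintype_fun_eq_card, Fintype.card_coe,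
    Fintype.card_subtype] at hrank
  have hsum : ∑ i, ((P i).card - 3 : ℤ) = (Finset.univ.filter fun i => (P i).card = 4).card := by
    rw [Finset.card_filter, Nat.cast_sum]
    refine Finset.sum_congr rfl fun i _ => ?_
    obtain h | ⟨_, _, _, -, h⟩ := hshape i <;> simp [h]
  rw [hsum]
  omega
end

section
/- Let a, b, c, d be integers with gcd(a,b) = gcd(c,d) = 1 and (a:b) ≠ (c:d), and let α, β, γ, δ be nonzero complex numbers. Then the curve {(αx^a + βy^b)(γx^c + δy^d) = 0} has exactly |Δ' ∩ ℤ²| − 3 nodes as its only singularities in (ℂ*)², where Δ' is the lattice parallelogram spanned by the vectors (a, −b) and (c, −d). -/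
/-- Second derivative of `F` at `z` as a bilinear expression. -/
noncomputable def D2 (F : ℂ × ℂ → ℂ) (z v w : ℂ × ℂ) : ℂ :=
  iteratedFDeriv ℂ 2 F z ![v, w]

/-- Third derivative of `F` at `z` as a trilinear expression. -/
noncomputable def D3 (F : ℂ × ℂ → ℂ) (z v w u : ℂ × ℂ) : ℂ :=
  iteratedFDeriv ℂ 3 F z ![v, w, u]

/-- `z` is a singular point of the plane curve `{F = 0}`. -/
def IsSingularAt (F : ℂ × ℂ → ℂ) (z : ℂ × ℂ) : Prop :=
  F z = 0 ∧ fderiv ℂ F z = 0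

/-- `z` is a node (A₁ singularity) of `{F = 0}`: a singular point with nondegenerate
Hessian. -/
def IsNode (F : ℂ × ℂ → ℂ) (z : ℂ × ℂ) : Prop :=
  IsSingularAt F z ∧
    D2 F z (1, 0) (1, 0) * D2 F z (0, 1) (0, 1) - D2 F z (1, 0) (0, 1) ^ 2 ≠ 0

/-- `z` is an ordinary cusp (A₂ singularity) of `{F = 0}`: a singular point whose Hessian
has rank one, with nonvanishing third derivative along the kernel direction. -/
def IsOrdinaryCusp (F : ℂ × ℂ → ℂ) (z : ℂ × ℂ) : Prop :=
  IsSingularAt F z ∧ iteratedFDeriv ℂ 2 F z ≠ 0 ∧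
    ∃ v : ℂ × ℂ, v ≠ 0 ∧ (∀ w : ℂ × ℂ, D2 F z v w = 0) ∧ D3 F z v v v ≠ 0

theorem ncard_zpow_eq {N : ℤ} (hN : N ≠ 0) {μ : ℂ} (hμ : μ ≠ 0) :
    {t : ℂ | t ^ N = μ}.ncard = N.natAbs := by
  have key : ∀ (n : ℕ) (ν : ℂ), n ≠ 0 → ν ≠ 0 → {t : ℂ | t ^ n = ν}.ncard = n := by
    intro n ν hn hν
    have hprim := Complex.isPrimitiveRoot_exp n hn
    obtain ⟨r, hr⟩ := IsAlgClosed.exists_pow_nat_eq ν (Nat.pos_of_ne_zero hn)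
    have hset : {t : ℂ | t ^ n = ν} = ((Polynomial.nthRoots n ν).toFinset : Set ℂ) := by
      ext t
      simp [Polynomial.mem_nthRoots (Nat.pos_of_ne_zero hn)]
    rw [hset, Set.ncard_coe_finset, Multiset.toFinset_card_of_nodup (hprim.nthRoots_nodup hν),
      hprim.card_nthRoots, if_pos ⟨r, hr⟩]
  rcases Int.natAbs_eq N with h | h
  · conv_lhs => rw [h]
    simpa only [zpow_natCast] using key N.natAbs μ (by simpa using hN) hμ
  · conv_lhs => rw [h]
    simpa only [zpow_neg, zpow_natCast, inv_eq_iff_eq_inv] using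
      key N.natAbs μ⁻¹ (by simpa using hN) (inv_ne_zero hμ)

theorem ncard_torus_solutions {a b c d : ℤ} (hab : Int.gcd a b = 1) (hdir : a * d ≠ b * c)
    {α β γ δ : ℂ} (hα : α ≠ 0) (hβ : β ≠ 0) (hγ : γ ≠ 0) (hδ : δ ≠ 0) :
    {z : ℂ × ℂ | z.1 ≠ 0 ∧ z.2 ≠ 0 ∧ α * z.1 ^ a + β * z.2 ^ b = 0 ∧
      γ * z.1 ^ c + δ * z.2 ^ d = 0}.ncard = (b * c - a * d).natAbs := by
  obtain ⟨u, v, huv⟩ : ∃ u v : ℤ, a * u + b * v = 1 :=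
    ⟨_, _, by rw [← Int.gcd_eq_gcd_ab, hab]; rfl⟩
  obtain ⟨κ, hκ0, hκ⟩ : ∃ κ : ℂ, κ ≠ 0 ∧ α * κ + β = 0 :=
    ⟨-β / α, by simp [hα, hβ], by field_simp; ring⟩
  obtain ⟨x₀, y₀, hx₀, hy₀, h₀⟩ : ∃ x₀ y₀ : ℂ, x₀ ≠ 0 ∧ y₀ ≠ 0 ∧ α * x₀ ^ a + β * y₀ ^ b = 0 := by
    refine ⟨κ ^ u, κ ^ (-v), zpow_ne_zero _ hκ0, zpow_ne_zero _ hκ0, ?_⟩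
    rw [← zpow_mul, ← zpow_mul, show u * a = 1 + -v * b by linear_combination huv, zpow_add₀ hκ0,
      zpow_one]
    linear_combination κ ^ (-v * b) * hκ
  have hN : b * c - a * d ≠ 0 := fun h => hdir (by linarith)
  have hμ : -(δ * y₀ ^ d) / (γ * x₀ ^ c) ≠ 0 := by
    simp [hδ, hγ, zpow_ne_zero, hx₀, hy₀]
  rw [← ncard_zpow_eq hN hμ]
  have hne : ∀ t : ℂ, t ^ (b * c - a * d) = -(δ * y₀ ^ d) / (γ * x₀ ^ c) → t ≠ 0 := by
    rintro t ht rfl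
    rw [zero_zpow _ hN] at ht
    exact hμ ht.symm
  have recover : ∀ t : ℂ, t ≠ 0 → (t ^ b) ^ v * (t ^ a) ^ u = t := by
    intro t ht
    rw [← zpow_mul, ← zpow_mul, ← zpow_add₀ ht, show b * v + a * u = 1 by linarith, zpow_one]
  have second : ∀ t : ℂ, t ≠ 0 → (γ * (x₀ * t ^ b) ^ c + δ * (y₀ * t ^ a) ^ d = 0 ↔
      t ^ (b * c - a * d) = -(δ * y₀ ^ d) / (γ * x₀ ^ c)) := by
    intro t ht
    have h1 := zpow_ne_zero c hx₀
    have h2 := zpow_ne_zero (a * d) ht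
    rw [zpow_sub₀ ht, div_eq_div_iff h2 (mul_ne_zero hγ h1), mul_zpow, mul_zpow, ← zpow_mul,
      ← zpow_mul]
    constructor <;> intro h <;> linear_combination h
  have hinj : Set.InjOn (fun t : ℂ => (x₀ * t ^ b, y₀ * t ^ a))
      {t | t ^ (b * c - a * d) = -(δ * y₀ ^ d) / (γ * x₀ ^ c)} := by
    intro t ht t' ht' h
    have h1 := mul_left_cancel₀ hx₀ (congrArg Prod.fst h)
    have h2 := mul_left_cancel₀ hy₀ (congrArg Prod.snd h)
    rw [← recover t (hne t ht), ← recover t' (hne t' ht'), h1, h2]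
  rw [← hinj.ncard_image]
  congr 1
  ext ⟨x, y⟩
  simp only [Set.mem_ofPred_eq, Set.mem_image, Prod.mk.injEq]
  constructor
  · rintro ⟨hx, hy, h1, h2⟩
    obtain ⟨X, rfl⟩ : ∃ X, x = x₀ * X := ⟨x / x₀, by field_simp⟩
    obtain ⟨Y, rfl⟩ : ∃ Y, y = y₀ * Y := ⟨y / y₀, by field_simp⟩
    have hX : X ≠ 0 := right_ne_zero_of_mul hx
    have hY : Y ≠ 0 := right_ne_zero_of_mul hy
    have hXY : X ^ a = Y ^ b := by
      have h3 := zpow_ne_zero a hx₀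
      refine mul_left_cancel₀ (mul_ne_zero hα h3) ?_
      rw [mul_zpow, mul_zpow] at h1
      linear_combination h1 - Y ^ b * h₀
    have hb : (X ^ v * Y ^ u) ^ b = X := by
      rw [mul_zpow, ← zpow_mul, ← zpow_mul, mul_comm u b, zpow_mul Y, ← hXY, ← zpow_mul,
        ← zpow_add₀ hX, show v * b + a * u = 1 by linarith, zpow_one]
    have ha : (X ^ v * Y ^ u) ^ a = Y := by
      rw [mul_zpow, ← zpow_mul, ← zpow_mul, mul_comm v a, zpow_mul X, hXY, ← zpow_mul,
        ← zpow_add₀ hY, show b * v + u * a = 1 by linarith, zpow_one]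
    have ht : X ^ v * Y ^ u ≠ 0 := mul_ne_zero (zpow_ne_zero _ hX) (zpow_ne_zero _ hY)
    exact ⟨X ^ v * Y ^ u, (second _ ht).1 (by rwa [ha, hb]), by rw [hb], by rw [ha]⟩
  · rintro ⟨t, ht, rfl, rfl⟩
    have ht0 := hne t ht
    refine ⟨mul_ne_zero hx₀ (zpow_ne_zero _ ht0), mul_ne_zero hy₀ (zpow_ne_zero _ ht0), ?_,
      (second t ht0).2 ht⟩
    rw [mul_zpow, mul_zpow, ← zpow_mul, ← zpow_mul, mul_comm b a]
    linear_combination t ^ (a * b) * h₀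

theorem ncard_lattice_strip {m : ℤ} {n : ℕ} (hn : 0 < n) (hmn : IsCoprime m (n : ℤ)) :
    {p : ℤ × ℤ | 0 ≤ p.2 ∧ p.2 ≤ n ∧ 0 ≤ n * p.1 - m * p.2 ∧ n * p.1 - m * p.2 ≤ n}.ncard =
      n + 3 := by
  have hn' : (0 : ℤ) < n := by exact_mod_cast hn
  let f : ℤ → ℤ × ℤ := fun y => (m * y / n + 1, y)
  have hf : Function.Injective f := fun y y' h => congrArg Prod.snd h
  have h0 : ((0, 0) : ℤ × ℤ) ∉ insert (m, (n : ℤ)) ((Finset.Icc (0 : ℤ) n).image f) := by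
    simp only [Finset.mem_insert, Finset.mem_image, Prod.mk.injEq, f]
    rintro (⟨-, h⟩ | ⟨y, -, h, rfl⟩)
    · omega
    · simp at h
  have h1 : (m, (n : ℤ)) ∉ (Finset.Icc (0 : ℤ) n).image f := by
    simp only [Finset.mem_image, Prod.mk.injEq, f]
    rintro ⟨y, -, h, rfl⟩
    rw [Int.mul_ediv_cancel _ hn'.ne'] at h
    omega
  have hset : {p : ℤ × ℤ | 0 ≤ p.2 ∧ p.2 ≤ n ∧ 0 ≤ n * p.1 - m * p.2 ∧
      n * p.1 - m * p.2 ≤ n} =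
      (insert (0, 0) (insert (m, (n : ℤ)) ((Finset.Icc (0 : ℤ) n).image f)) :
        Finset (ℤ × ℤ)) := by
    ext ⟨x, y⟩
    simp only [Set.mem_ofPred_eq, Finset.coe_insert, Finset.coe_image, Set.mem_insert_iff,
      Set.mem_image, Prod.mk.injEq, f, Finset.coe_Icc, Set.mem_Icc]
    have hdm := Int.mul_ediv_add_emod (m * y) n
    have hr0 := Int.emod_nonneg (m * y) hn'.ne'
    have hrn := Int.emod_lt_of_pos (m * y) hn'
    constructor
    · rintro ⟨hy0, hyn, hl, hu⟩
      by_cases hx : x = m * y / n + 1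
      · exact Or.inr (Or.inr ⟨y, ⟨hy0, hyn⟩, hx.symm, rfl⟩)
      have hxq : x = m * y / n := by
        have h2 : x < m * y / n + 2 := by
          by_contra! h
          nlinarith
        have h3 : m * y / n - 1 < x := by
          by_contra! h
          nlinarith
        omega
      have hnx : (n : ℤ) * x = m * y := by
        rw [← hxq] at hdm
        nlinarith
      have hdvd : (n : ℤ) ∣ y := hmn.symm.dvd_of_dvd_mul_left ⟨x, hnx.symm⟩
      rcases hy0.eq_or_lt with rfl | hpos
      · left
        simpa [hn.ne'] using hnx
      · have hyn' : y = n := le_antisymm hyn (Int.le_of_dvd hpos hdvd)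
        subst hyn'
        right; left
        exact ⟨mul_left_cancel₀ hn'.ne' (by linarith), rfl⟩
    · rintro (⟨rfl, rfl⟩ | ⟨rfl, rfl⟩ | ⟨y, ⟨hy0, hyn⟩, rfl, rfl⟩)
      · simp
      · refine ⟨hn'.le, le_rfl, ?_, ?_⟩ <;> nlinarith
      · refine ⟨hy0, hyn, ?_, ?_⟩ <;> nlinarith
  rw [hset, Set.ncard_coe_finset, Finset.card_insert_of_notMem h0, Finset.card_insert_of_notMem h1,
    Finset.card_image_of_injective _ hf, Int.card_Icc]
  omega

open scoped Pointwise in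
theorem mem_convexHull_parallelogram_s6 {E : Type*} [AddCommGroup E] [Module ℝ E] (A B x : E) :
    x ∈ convexHull ℝ ({0, A, B, A + B} : Set E) ↔
      ∃ s t : ℝ, (0 ≤ s ∧ s ≤ 1) ∧ (0 ≤ t ∧ t ≤ 1) ∧ s • A + t • B = x := by
  have h : ({0, A, B, A + B} : Set E) = ({0, A} : Set E) + ({0, B} : Set E) := by
    ext y
    simp only [Set.mem_add, Set.mem_insert_iff, Set.mem_singleton_iff]
    constructor
    · rintro (rfl | rfl | rfl | rfl)
      · exact ⟨0, .inl rfl, 0, .inl rfl, by simp⟩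
      · exact ⟨y, .inr rfl, 0, .inl rfl, by simp⟩
      · exact ⟨0, .inl rfl, y, .inr rfl, by simp⟩
      · exact ⟨A, .inr rfl, B, .inr rfl, rfl⟩
    · rintro ⟨_, rfl | rfl, _, rfl | rfl, rfl⟩ <;> simp
  rw [h, convexHull_add, convexHull_pair, convexHull_pair, segment_eq_image, segment_eq_image]
  simp only [Set.mem_add, Set.mem_image, Set.mem_Icc, smul_zero, zero_add]
  constructor
  · rintro ⟨_, ⟨s, hs, rfl⟩, _, ⟨t, ht, rfl⟩, rfl⟩
    exact ⟨s, t, hs, ht, rfl⟩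
  · rintro ⟨s, t, hs, ht, rfl⟩
    exact ⟨_, ⟨s, hs, rfl⟩, _, ⟨t, ht, rfl⟩, rfl⟩

theorem ncard_lattice_parallelogram {a b c d : ℤ} (hab : Int.gcd a b = 1)
    (hcd : Int.gcd c d = 1) (hdir : a * d ≠ b * c) :
    Set.ncard {p : ℤ × ℤ | toR p ∈ convexHull ℝ
        {((0 : ℝ), (0 : ℝ)), ((a : ℝ), (-b : ℝ)), ((c : ℝ), (-d : ℝ)),
          ((a : ℝ) + (c : ℝ), -(b : ℝ) - (d : ℝ))}} = (b * c - a * d).natAbs + 3 := by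
  obtain ⟨u, v, huv⟩ : ∃ u v : ℤ, a * u + b * v = 1 :=
    ⟨_, _, by rw [← Int.gcd_eq_gcd_ab, hab]; rfl⟩
  obtain ⟨k, l, hkl⟩ : ∃ k l : ℤ, c * k + d * l = 1 :=
    ⟨_, _, by rw [← Int.gcd_eq_gcd_ab, hcd]; rfl⟩
  have hN : b * c - a * d ≠ 0 := fun h => hdir (by linarith)
  obtain ⟨σ, hσ, hσN⟩ : ∃ σ : ℤ, σ * σ = 1 ∧ ((b * c - a * d).natAbs : ℤ) = σ * (b * c - a * d) := by
    rcases Int.natAbs_eq (b * c - a * d) with h | h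
    · exact ⟨1, rfl, by linarith⟩
    · exact ⟨-1, rfl, by linarith⟩
  have hn : 0 < (b * c - a * d).natAbs := Int.natAbs_pos.2 hN
  generalize (b * c - a * d).natAbs = n at hσN hn ⊢
  have hcop : IsCoprime (u * c + v * d) (n : ℤ) := by
    refine ⟨k * a + l * b, σ * (k * v - l * u), ?_⟩
    rw [hσN]
    linear_combination (k * v - l * u) * (b * c - a * d) * hσ + (c * k + d * l) * huv + hkl
  rw [← ncard_lattice_strip hn hcop]
  let e : ℤ × ℤ → ℤ × ℤ := fun p => (a * p.1 + v * σ * p.2, -b * p.1 + u * σ * p.2)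
  have he : Function.Injective e := by
    rintro ⟨x, y⟩ ⟨x', y'⟩ h
    simp only [e, Prod.mk.injEq] at h
    obtain ⟨h1, h2⟩ := h
    ext
    · change x = x'
      linear_combination u * h1 - v * h2 - (x - x') * huv
    · change y = y'
      linear_combination σ * b * h1 + σ * a * h2 - (y - y') * hσ - σ * σ * (y - y') * huv
  symm
  rw [← Set.ncard_image_of_injective _ he]
  symm
  congr 1
  have hvert : ({((0 : ℝ), (0 : ℝ)), ((a : ℝ), (-b : ℝ)), ((c : ℝ), (-d : ℝ)),
      ((a : ℝ) + (c : ℝ), -(b : ℝ) - (d : ℝ))} : Set (ℝ × ℝ)) =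
      {0, ((a : ℝ), (-b : ℝ)), ((c : ℝ), (-d : ℝ)),
        ((a : ℝ), (-b : ℝ)) + ((c : ℝ), (-d : ℝ))} := by
    simp [sub_eq_add_neg, Prod.zero_eq_mk]
  have hnR : (0 : ℝ) < n := by exact_mod_cast hn
  have huvR : (a * u + b * v : ℝ) = 1 := by exact_mod_cast huv
  have hσR : (σ * σ : ℝ) = 1 := by exact_mod_cast hσ
  have hσNR : (n : ℝ) = σ * (b * c - a * d) := by exact_mod_cast hσN
  rw [hvert]
  ext ⟨p, q⟩
  rw [Set.mem_ofPred_eq, mem_convexHull_parallelogram_s6]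
  simp only [Set.mem_ofPred_eq, Set.mem_image, toR, e, Prod.exists, Prod.smul_mk, smul_eq_mul, Prod.mk_add_mk, Prod.mk.injEq]
  constructor
  · rintro ⟨s, t, ⟨hs0, hs1⟩, ⟨ht0, ht1⟩, hp, hq⟩
    have hY : ((σ * (p * b + q * a) : ℤ) : ℝ) = t * n := by
      push_cast
      rw [hσNR, ← hp, ← hq]
      ring
    have hX : ((n * (u * p - v * q) - (u * c + v * d) * (σ * (p * b + q * a)) : ℤ) : ℝ)
        = n * s := by
      rw [Int.cast_sub, Int.cast_mul _ (σ * _), hY]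
      push_cast
      rw [← hp, ← hq]
      linear_combination n * s * huvR
    refine ⟨u * p - v * q, σ * (p * b + q * a), ⟨?_, ?_, ?_, ?_⟩, ?_, ?_⟩
    · rw [← Int.cast_nonneg_iff (R := ℝ), hY]; positivity
    · rw [← Int.cast_le (R := ℝ), hY, Int.cast_natCast]; nlinarith
    · rw [← Int.cast_nonneg_iff (R := ℝ), hX]; positivity
    · rw [← Int.cast_le (R := ℝ), hX, Int.cast_natCast]; nlinarith
    · linear_combination v * (p * b + q * a) * hσ + p * huv
    · linear_combination u * (p * b + q * a) * hσ + q * huv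
  · rintro ⟨x, y, ⟨hy0, hyn, hl, hu⟩, rfl, rfl⟩
    have hy0' : (0 : ℝ) ≤ y := by exact_mod_cast hy0
    have hyn' : (y : ℝ) ≤ n := by exact_mod_cast hyn
    have hl' : (0 : ℝ) ≤ n * x - (u * c + v * d) * y := by exact_mod_cast hl
    have hu' : (n * x - (u * c + v * d) * y : ℝ) ≤ n := by exact_mod_cast hu
    refine ⟨(n * x - (u * c + v * d) * y) / n, y / n,
      ⟨by positivity, (div_le_one hnR).2 hu'⟩, ⟨by positivity, (div_le_one hnR).2 hyn'⟩, ?_, ?_⟩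
    · push_cast
      field_simp
      rw [hσNR]
      linear_combination -v * y * (b * c - a * d) * hσR - c * y * huvR
    · push_cast
      field_simp
      rw [hσNR]
      linear_combination -u * y * (b * c - a * d) * hσR + d * y * huvR

theorem D2_mul_of_eq_zero {P Q : ℂ × ℂ → ℂ} {z : ℂ × ℂ} (hP : ContDiffAt ℂ 2 P z)
    (hQ : ContDiffAt ℂ 2 Q z) (hPz : P z = 0) (hQz : Q z = 0) (v w : ℂ × ℂ) :
    D2 (fun y => P y * Q y) z v w =
      fderiv ℂ P z v * fderiv ℂ Q z w + fderiv ℂ Q z v * fderiv ℂ P z w := by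
  have hev : fderiv ℂ (fun y => P y * Q y) =ᶠ[nhds z]
      fun y => P y • fderiv ℂ Q y + Q y • fderiv ℂ P y := by
    filter_upwards [hP.eventually (by simp), hQ.eventually (by simp)] with y hPy hQy
    exact fderiv_fun_mul (hPy.differentiableAt (by simp)) (hQy.differentiableAt (by simp))
  have dP := hP.differentiableAt (by simp)
  have dQ := hQ.differentiableAt (by simp)
  have dP' := (hP.fderiv_right (m := 1) (by norm_num)).differentiableAt (by simp)
  have dQ' := (hQ.fderiv_right (m := 1) (by norm_num)).differentiableAt (by simp)
  rw [D2, iteratedFDeriv_two_apply, hev.fderiv_eq, fderiv_fun_add (dP.fun_smul dQ') (dQ.fun_smul dP'),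
    fderiv_fun_smul dP dQ', fderiv_fun_smul dQ dP']
  simp [hPz, hQz]

theorem contDiffAt_binomial (α β : ℂ) (a b : ℤ) {z : ℂ × ℂ} (h1 : z.1 ≠ 0) (h2 : z.2 ≠ 0) :
    ContDiffAt ℂ 2 (fun z : ℂ × ℂ => α * z.1 ^ a + β * z.2 ^ b) z := by
  have key : ∀ (n : ℤ) (x : ℂ), x ≠ 0 → ContDiffAt ℂ 2 (fun x : ℂ => x ^ n) x := by
    intro n x hx
    exact (analyticAt_id.zpow hx).contDiffAt
  exact (contDiffAt_const.mul ((key a z.1 h1).comp z contDiffAt_fst)).add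
    (contDiffAt_const.mul ((key b z.2 h2).comp z contDiffAt_snd))

theorem fderiv_binomial (α β : ℂ) (a b : ℤ) {z : ℂ × ℂ} (h1 : z.1 ≠ 0) (h2 : z.2 ≠ 0)
    (v : ℂ × ℂ) :
    fderiv ℂ (fun z : ℂ × ℂ => α * z.1 ^ a + β * z.2 ^ b) z v =
      α * (a * z.1 ^ (a - 1) * v.1) + β * (b * z.2 ^ (b - 1) * v.2) := by
  have e1 := ((hasDerivAt_zpow a z.1 (.inl h1)).comp_hasFDerivAt z
    (hasFDerivAt_fst (𝕜 := ℂ) (p := z))).const_mul α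
  have e2 := ((hasDerivAt_zpow b z.2 (.inl h2)).comp_hasFDerivAt z
    (hasFDerivAt_snd (𝕜 := ℂ) (p := z))).const_mul β
  have e := (e1.add e2).fderiv
  have := congrArg (fun L : ℂ × ℂ →L[ℂ] ℂ => L v) e
  simpa [Function.comp_def, Pi.add_def] using this

theorem fderiv_binomial_ne_zero {α β : ℂ} (hα : α ≠ 0) (hβ : β ≠ 0) {a b : ℤ}
    (hab : Int.gcd a b = 1) {z : ℂ × ℂ} (h1 : z.1 ≠ 0) (h2 : z.2 ≠ 0) :
    fderiv ℂ (fun z : ℂ × ℂ => α * z.1 ^ a + β * z.2 ^ b) z ≠ 0 := by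
  intro h
  have e1 := fderiv_binomial α β a b h1 h2 (1, 0)
  have e2 := fderiv_binomial α β a b h1 h2 (0, 1)
  rw [h] at e1 e2
  have ha : a = 0 := by simpa [hα, zpow_ne_zero, h1] using e1.symm
  have hb : b = 0 := by simpa [hβ, zpow_ne_zero, h2] using e2.symm
  simp [ha, hb] at hab

theorem isSingularAt_mul_iff {P Q : ℂ × ℂ → ℂ} {z : ℂ × ℂ} (hP : DifferentiableAt ℂ P z)
    (hQ : DifferentiableAt ℂ Q z) (hP' : fderiv ℂ P z ≠ 0) (hQ' : fderiv ℂ Q z ≠ 0) :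
    IsSingularAt (fun y => P y * Q y) z ↔ P z = 0 ∧ Q z = 0 := by
  have hd : ∀ v, fderiv ℂ (fun y => P y * Q y) z v =
      P z * fderiv ℂ Q z v + Q z * fderiv ℂ P z v := fun v => by
    rw [fderiv_fun_mul hP hQ]
    rfl
  rw [IsSingularAt]
  constructor
  · rintro ⟨h, h'⟩
    have h0 : ∀ v, P z * fderiv ℂ Q z v + Q z * fderiv ℂ P z v = 0 := fun v => by
      rw [← hd, h']
      rfl
    rcases mul_eq_zero.1 h with h | h
    · refine ⟨h, by_contra fun hne => hP' (ContinuousLinearMap.ext fun v => ?_)⟩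
      simpa [h, hne] using h0 v
    · refine ⟨by_contra fun hne => hQ' (ContinuousLinearMap.ext fun v => ?_), h⟩
      simpa [h, hne] using h0 v
  · rintro ⟨h, h'⟩
    refine ⟨by simp [h], ContinuousLinearMap.ext fun v => ?_⟩
    rw [hd, h, h']
    simp

/-- for coprime (a,b), (c,d) with distinct directions, the curve
`(αx^a + βy^b)(γx^c + δy^d) = 0` has exactly `|Δ' ∩ ℤ²| − 3` nodes as its only
singularities in the torus, where `Δ'` is the parallelogram spanned by `(a,−b)`, `(c,−d)`. -/
theorem nodes_of_product_of_binomials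
    (a b c d : ℤ) (hab : Int.gcd a b = 1) (hcd : Int.gcd c d = 1)
    (hdir : a * d ≠ b * c)
    (α β γ δ : ℂ) (hα : α ≠ 0) (hβ : β ≠ 0) (hγ : γ ≠ 0) (hδ : δ ≠ 0)
    (F : ℂ × ℂ → ℂ)
    (hF : ∀ z : ℂ × ℂ, F z = (α * z.1 ^ a + β * z.2 ^ b) * (γ * z.1 ^ c + δ * z.2 ^ d)) :
    (∀ z : ℂ × ℂ, z.1 ≠ 0 → z.2 ≠ 0 → IsSingularAt F z → IsNode F z) ∧
    Set.ncard {z : ℂ × ℂ | z.1 ≠ 0 ∧ z.2 ≠ 0 ∧ IsSingularAt F z} + 3 =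
      Set.ncard {p : ℤ × ℤ | toR p ∈ convexHull ℝ
        {((0 : ℝ), (0 : ℝ)), ((a : ℝ), (-b : ℝ)), ((c : ℝ), (-d : ℝ)),
          ((a : ℝ) + (c : ℝ), -(b : ℝ) - (d : ℝ))}} := by
  obtain rfl : F = fun z => (α * z.1 ^ a + β * z.2 ^ b) * (γ * z.1 ^ c + δ * z.2 ^ d) := funext hF
  have sing : ∀ z : ℂ × ℂ, z.1 ≠ 0 → z.2 ≠ 0 →
      (IsSingularAt (fun z => (α * z.1 ^ a + β * z.2 ^ b) * (γ * z.1 ^ c + δ * z.2 ^ d)) z ↔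
        α * z.1 ^ a + β * z.2 ^ b = 0 ∧ γ * z.1 ^ c + δ * z.2 ^ d = 0) := fun z h1 h2 =>
    isSingularAt_mul_iff ((contDiffAt_binomial α β a b h1 h2).differentiableAt (by simp))
      ((contDiffAt_binomial γ δ c d h1 h2).differentiableAt (by simp))
      (fderiv_binomial_ne_zero hα hβ hab h1 h2) (fderiv_binomial_ne_zero hγ hδ hcd h1 h2)
  constructor
  · intro z h1 h2 hz
    refine ⟨hz, ?_⟩
    obtain ⟨hP, hQ⟩ := (sing z h1 h2).1 hz
    simp only [D2_mul_of_eq_zero (contDiffAt_binomial α β a b h1 h2)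
      (contDiffAt_binomial γ δ c d h1 h2) hP hQ, fderiv_binomial _ _ _ _ h1 h2,
      zpow_sub_one₀ h1, zpow_sub_one₀ h2]
    have hne : α * γ * z.1 ^ a * z.1 ^ c * (b * c - a * d) * z.1⁻¹ * z.2⁻¹ ≠ 0 := by
      have : (b * c - a * d : ℂ) ≠ 0 := by
        rw [sub_ne_zero]
        exact_mod_cast hdir.symm
      simp [hα, hγ, h1, h2, this, zpow_ne_zero]
    have hβ' : β * z.2 ^ b = -(α * z.1 ^ a) := by linear_combination hP
    have hδ' : δ * z.2 ^ d = -(γ * z.1 ^ c) := by linear_combination hQ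
    have hJ : (α * (a * (z.1 ^ a * z.1⁻¹))) * (d * (δ * z.2 ^ d) * z.2⁻¹) -
        (b * (β * z.2 ^ b) * z.2⁻¹) * (γ * (c * (z.1 ^ c * z.1⁻¹))) =
        α * γ * z.1 ^ a * z.1 ^ c * (b * c - a * d) * z.1⁻¹ * z.2⁻¹ := by
      rw [hβ', hδ']
      ring
    rw [← hJ] at hne
    refine fun h => hne (pow_eq_zero_iff two_ne_zero |>.1 ?_)
    linear_combination -h
  · rw [ncard_lattice_parallelogram hab hcd hdir,
      ← ncard_torus_solutions hab hdir hα hβ hγ hδ]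
    congr 2
    ext z
    simp only [Set.mem_ofPred_eq]
    exact and_congr_right fun h1 => and_congr_right fun h2 => sing z h1 h2
end

section
/- Fix an integer m ≥ 2 and nonzero complex numbers a, b, c. Among polynomials F(x,y) = a y² + b y g(x) + c where g is a monic degree-m polynomial in x, those defining a rational plane curve form exactly m disjoint one-dimensional families; each family contains a unique representative in which the coefficient of x^{m−1} in g vanishes, and every member of the family is obtained from this representative by a coordinate shift x ↦ x + t. Moreover, every such rational curve has exactly m−1 nodes in ℂ² as its only singularities. -/
/-- The curve a y² + b y g(x) + c associated with a polynomial g. -/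
noncomputable def curveF (a b c : ℂ) (g : Polynomial ℂ) : ℂ × ℂ → ℂ := fun z =>
  a * z.2 ^ 2 + b * z.2 * Polynomial.eval z.1 g + c

/-- The curve {F = 0} admits a nonconstant rational parametrization (is rational). -/
def IsRationalMember (a b c : ℂ) (g : Polynomial ℂ) : Prop :=
  ∃ u v : RatFunc ℂ, (∀ r : ℂ, u ≠ RatFunc.C r) ∧
    RatFunc.C a * v ^ 2 + RatFunc.C b * v * Polynomial.aeval u g + RatFunc.C c = 0

section

open Polynomial

theorem dickson_one_eval_add {R : Type*} [CommRing R] (s t : R) : ∀ n : ℕ,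
    (dickson 1 (s * t) n).eval (s + t) = s ^ n + t ^ n
  | 0 => by rw [dickson_zero]; norm_num
  | 1 => by simp
  | n + 2 => by
    simp only [dickson_add_two, eval_sub, eval_mul, eval_X, eval_C,
      dickson_one_eval_add s t (n + 1), dickson_one_eval_add s t n]
    ring

theorem dickson_one_derivative_eval_add (s t : ℂ) : ∀ n : ℕ,
    (derivative (dickson 1 (s * t) n)).eval (s + t) * (s - t) = n * (s ^ n - t ^ n)
  | 0 => by
    have h : dickson 1 (s * t) 0 = C (2 : ℂ) := by
      rw [dickson_zero, show C (2 : ℂ) = 2 from rfl]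
      norm_num
    simp [h]
  | 1 => by simp
  | n + 2 => by
    have h1 := dickson_one_derivative_eval_add s t (n + 1)
    have h0 := dickson_one_derivative_eval_add s t n
    have e1 := dickson_one_eval_add s t (n + 1)
    simp only [dickson_add_two, derivative_sub, derivative_mul, derivative_X, derivative_C,
      eval_sub, eval_add, eval_mul, eval_X, eval_C, eval_one, eval_zero, e1]
    push_cast at h1 ⊢
    linear_combination (s + t) * h1 - s * t * h0

theorem exists_add_eq_mul_eq (x β : ℂ) : ∃ s t : ℂ, s + t = x ∧ s * t = β := by
  obtain ⟨d, hd⟩ := IsAlgClosed.exists_pow_nat_eq (x ^ 2 - 4 * β) (n := 2) (by norm_num)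
  exact ⟨(x + d) / 2, (x - d) / 2, by ring, by linear_combination (-1 / 4 : ℂ) * hd⟩

theorem dickson_one_pell (β : ℂ) (n : ℕ) :
    C ((n : ℂ) ^ 2) * (dickson 1 β n ^ 2 - C (4 * β ^ n)) =
      (X ^ 2 - C (4 * β)) * derivative (dickson 1 β n) ^ 2 := by
  refine Polynomial.funext fun x => ?_
  obtain ⟨s, t, rfl, rfl⟩ := exists_add_eq_mul_eq x β
  have h := dickson_one_derivative_eval_add s t n
  have e := dickson_one_eval_add s t n
  simp only [eval_mul, eval_sub, eval_pow, eval_C, eval_X, e]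
  have h2 := congrArg (· ^ 2) h
  simp only [mul_pow] at h2 ⊢
  linear_combination -h2

theorem dickson_one_monic_natDegree (β : ℂ) : ∀ n : ℕ,
    (dickson 1 β (n + 1)).Monic ∧ (dickson 1 β (n + 1)).natDegree = n + 1
  | 0 => by simp [monic_X]
  | 1 => by
    have h : dickson 1 β 2 = X ^ 2 - C (β * 2) := by
      rw [dickson_two, map_mul, show C (2 : ℂ) = 2 from rfl]; norm_num
    rw [h]
    exact ⟨monic_X_pow_sub_C _ two_ne_zero, natDegree_X_pow_sub_C⟩
  | n + 2 => by
    obtain ⟨m1, d1⟩ := dickson_one_monic_natDegree β (n + 1)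
    obtain ⟨m0, d0⟩ := dickson_one_monic_natDegree β n
    have hm : (X * dickson 1 β (n + 1 + 1)).Monic := monic_X.mul m1
    have hd : (X * dickson 1 β (n + 1 + 1)).natDegree = n + 3 := by
      rw [monic_X.natDegree_mul m1, d1, natDegree_X]; ring
    have hlt : (C β * dickson 1 β (n + 1)).natDegree < n + 3 :=
      (natDegree_C_mul_le _ _).trans_lt (by omega)
    have hlt' : (C β * dickson 1 β (n + 1)).degree < (X * dickson 1 β (n + 1 + 1)).degree :=
      degree_lt_degree (by omega)
    rw [show n + 2 + 1 = n + 1 + 2 from rfl, dickson_add_two]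
    exact ⟨hm.sub_of_left hlt', by
      rw [natDegree_sub_eq_left_of_natDegree_lt (by omega), hd]⟩

/-- Differentiating the Pell-type equation gives a linear second order equation. -/
theorem linear_of_pell {m : ℕ} {γ p q : ℂ} {g : ℂ[X]} (hg : derivative g ≠ 0)
    (h : C ((m : ℂ) ^ 2) * (g ^ 2 - C (4 * γ)) =
      (X ^ 2 + C p * X + C q) * derivative g ^ 2) :
    C (2 * (m : ℂ) ^ 2) * g = (C 2 * X + C p) * derivative g +
      C 2 * (X ^ 2 + C p * X + C q) * derivative (derivative g) := by
  have h' := congrArg derivative h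
  simp only [derivative_mul, derivative_sub, derivative_C, derivative_add,
    derivative_X, derivative_pow] at h'
  refine mul_left_cancel₀ hg ?_
  simp only [map_mul, map_pow, map_natCast, show C (2 : ℂ) = 2 from rfl, Nat.cast_ofNat] at h' ⊢
  norm_num at h'
  linear_combination h'

theorem coeff_X_mul_derivative (f : ℂ[X]) (j : ℕ) :
    (X * derivative f).coeff j = j * f.coeff j := by
  cases j with
  | zero => simp
  | succ j => rw [coeff_X_mul, coeff_derivative]; push_cast; ring

theorem coeff_of_linear {m : ℕ} {p q : ℂ} {g : ℂ[X]}
    (h : C (2 * (m : ℂ) ^ 2) * g = (C 2 * X + C p) * derivative g +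
      C 2 * (X ^ 2 + C p * X + C q) * derivative (derivative g)) (j : ℕ) :
    2 * ((m : ℂ) ^ 2 - j ^ 2) * g.coeff j =
      p * (2 * j + 1) * (j + 1) * g.coeff (j + 1) +
        2 * q * (j + 2) * (j + 1) * g.coeff (j + 2) := by
  have h' : C (2 * (m : ℂ) ^ 2) * g = C 2 * (X * derivative (X * derivative g)) +
      C p * (C 2 * derivative (X * derivative g) - derivative g) +
      C (2 * q) * derivative (derivative g) := by
    rw [h]
    simp only [derivative_mul, derivative_X, map_mul]
    rw [show (C (2 : ℂ)) = 2 from rfl]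
    ring
  have := congrArg (fun f => coeff f j) h'
  simp only [coeff_add, coeff_sub, coeff_C_mul, coeff_X_mul_derivative, coeff_derivative] at this
  push_cast at this
  linear_combination this

theorem coeff_pred_of_linear {n : ℕ} {p q : ℂ} {g : ℂ[X]} (hm : g.Monic)
    (hd : g.natDegree = n + 1)
    (h : C (2 * ((n + 1 : ℕ) : ℂ) ^ 2) * g = (C 2 * X + C p) * derivative g +
      C 2 * (X ^ 2 + C p * X + C q) * derivative (derivative g)) :
    2 * g.coeff n = (n + 1) * p := by
  have := coeff_of_linear h n
  have h1 : g.coeff (n + 1) = 1 := hd ▸ hm.coeff_natDegree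
  rw [h1, coeff_eq_zero_of_natDegree_lt (show g.natDegree < n + 2 by omega)] at this
  have h2 : (2 * n + 1 : ℂ) ≠ 0 := by exact_mod_cast (by omega : 2 * n + 1 ≠ 0)
  refine mul_left_cancel₀ h2 ?_
  push_cast at this
  linear_combination this

theorem eq_of_linear {m : ℕ} {p q : ℂ} {f g : ℂ[X]} (hfm : f.Monic) (hgm : g.Monic)
    (hfd : f.natDegree = m) (hgd : g.natDegree = m)
    (hf : C (2 * (m : ℂ) ^ 2) * f = (C 2 * X + C p) * derivative f +
      C 2 * (X ^ 2 + C p * X + C q) * derivative (derivative f))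
    (hg : C (2 * (m : ℂ) ^ 2) * g = (C 2 * X + C p) * derivative g +
      C 2 * (X ^ 2 + C p * X + C q) * derivative (derivative g)) : f = g := by
  by_contra hne
  have hne' : f - g ≠ 0 := sub_ne_zero.mpr hne
  have hlt : (f - g).natDegree < m := by
    have hdeg : f.degree = g.degree := by
      rw [degree_eq_natDegree hfm.ne_zero, degree_eq_natDegree hgm.ne_zero, hfd, hgd]
    have := degree_sub_lt_left hdeg hfm.ne_zero (by rw [hfm, hgm])
    rw [← hfd]
    exact natDegree_lt_natDegree hne' this
  have h : C (2 * (m : ℂ) ^ 2) * (f - g) = (C 2 * X + C p) * derivative (f - g) +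
      C 2 * (X ^ 2 + C p * X + C q) * derivative (derivative (f - g)) := by
    simp only [derivative_sub]
    linear_combination hf - hg
  have hc := coeff_of_linear h (f - g).natDegree
  rw [coeff_eq_zero_of_natDegree_lt (show (f - g).natDegree < (f - g).natDegree + 1 by omega),
    coeff_eq_zero_of_natDegree_lt (show (f - g).natDegree < (f - g).natDegree + 2 by omega)] at hc
  simp only [mul_zero, add_zero, mul_eq_zero, two_ne_zero, false_or, coeff_natDegree,
    leadingCoeff_eq_zero, hne', or_false] at hc
  have h3 : m ^ 2 = (f - g).natDegree ^ 2 := by exact_mod_cast sub_eq_zero.mp hc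
  have := Nat.pow_left_injective two_ne_zero h3
  omega

/-- Translating the variable in the Pell-type equation. -/
theorem pell_comp {m : ℕ} {γ p q : ℂ} {g : ℂ[X]}
    (h : C ((m : ℂ) ^ 2) * (g ^ 2 - C (4 * γ)) =
      (X ^ 2 + C p * X + C q) * derivative g ^ 2) (t : ℂ) :
    C ((m : ℂ) ^ 2) * (g.comp (X + C t) ^ 2 - C (4 * γ)) =
      (X ^ 2 + C (p + 2 * t) * X + C (t ^ 2 + p * t + q)) *
        derivative (g.comp (X + C t)) ^ 2 := by
  have h' := congrArg (fun f => f.comp (X + C t)) h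
  simp only [mul_comp, sub_comp, pow_comp, C_comp, add_comp, X_comp] at h'
  rw [h']
  simp only [derivative_comp, derivative_X, derivative_C, map_add, map_mul,
    map_pow]
  rw [show (C (2 : ℂ)) = 2 from rfl]
  ring

theorem pell_unique {m : ℕ} {γ p q p' q' : ℂ} {g : ℂ[X]} (hg : derivative g ≠ 0)
    (h : C ((m : ℂ) ^ 2) * (g ^ 2 - C (4 * γ)) =
      (X ^ 2 + C p * X + C q) * derivative g ^ 2)
    (h' : C ((m : ℂ) ^ 2) * (g ^ 2 - C (4 * γ)) =
      (X ^ 2 + C p' * X + C q') * derivative g ^ 2) : p = p' ∧ q = q' := by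
  have e := mul_right_cancel₀ (pow_ne_zero 2 hg) (h.symm.trans h')
  have e0 := congrArg (eval 0) e
  have e1 := congrArg (eval 1) e
  simp at e0 e1
  exact ⟨by linear_combination e1 - e0, e0⟩

theorem hasFDerivAt_curveF (a b c : ℂ) (g : ℂ[X]) (z : ℂ × ℂ) :
    HasFDerivAt (curveF a b c g)
      ((b * z.2 * (derivative g).eval z.1) • ContinuousLinearMap.fst ℂ ℂ ℂ +
        (2 * a * z.2 + b * g.eval z.1) • ContinuousLinearMap.snd ℂ ℂ ℂ) z := by
  have h1 : HasFDerivAt (fun z : ℂ × ℂ => g.eval z.1)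
      ((derivative g).eval z.1 • ContinuousLinearMap.fst ℂ ℂ ℂ) z :=
    (g.hasDerivAt z.1).comp_hasFDerivAt z hasFDerivAt_fst
  have h2 : HasFDerivAt (fun z : ℂ × ℂ => z.2) (ContinuousLinearMap.snd ℂ ℂ ℂ) z :=
    hasFDerivAt_snd
  have h := (((h2.pow 2).const_mul a).add ((h2.const_mul b).mul h1)).add_const c
  refine h.congr_fderiv ?_
  ext
  · simp
  · simp
    ring

theorem fderiv_curveF (a b c : ℂ) (g : ℂ[X]) :
    fderiv ℂ (curveF a b c g) = fun z =>
      (b * z.2 * (derivative g).eval z.1) • ContinuousLinearMap.fst ℂ ℂ ℂ +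
        (2 * a * z.2 + b * g.eval z.1) • ContinuousLinearMap.snd ℂ ℂ ℂ :=
  funext fun z => (hasFDerivAt_curveF a b c g z).fderiv

theorem D2_curveF (a b c : ℂ) (g : ℂ[X]) (z v w : ℂ × ℂ) :
    D2 (curveF a b c g) z v w =
      (b * v.2 * (derivative g).eval z.1 +
        b * z.2 * (derivative (derivative g)).eval z.1 * v.1) * w.1 +
      (2 * a * v.2 + b * (derivative g).eval z.1 * v.1) * w.2 := by
  have hev : ∀ f : ℂ[X], HasFDerivAt (fun z : ℂ × ℂ => f.eval z.1)
      ((derivative f).eval z.1 • ContinuousLinearMap.fst ℂ ℂ ℂ) z := fun f =>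
    (f.hasDerivAt z.1).comp_hasFDerivAt z hasFDerivAt_fst
  have h2 : HasFDerivAt (fun z : ℂ × ℂ => z.2) (ContinuousLinearMap.snd ℂ ℂ ℂ) z :=
    hasFDerivAt_snd
  have h := ((((h2.const_mul b).mul (hev (derivative g))).smul_const
    (ContinuousLinearMap.fst ℂ ℂ ℂ)).add
    (((h2.const_mul (2 * a)).add ((hev g).const_mul b)).smul_const
      (ContinuousLinearMap.snd ℂ ℂ ℂ))).fderiv
  rw [D2, iteratedFDeriv_two_apply, fderiv_curveF]
  erw [h]
  simp
  ring

theorem isSingularAt_curveF_iff {a b c : ℂ} (ha : a ≠ 0) (hb : b ≠ 0) (hc : c ≠ 0) {m : ℕ}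
    (hm : m ≠ 0) {Q g : ℂ[X]}
    (h : C ((m : ℂ) ^ 2) * (g ^ 2 - C (4 * (a * c / b ^ 2))) = Q * derivative g ^ 2)
    (z : ℂ × ℂ) :
    IsSingularAt (curveF a b c g) z ↔
      (derivative g).eval z.1 = 0 ∧ z.2 = -(b * g.eval z.1) / (2 * a) := by
  have hz := congrArg (eval z.1) h
  simp only [eval_mul, eval_C, eval_sub, eval_pow] at hz
  have hm' : (m : ℂ) ≠ 0 := Nat.cast_ne_zero.mpr hm
  simp only [IsSingularAt, fderiv_curveF, curveF]
  constructor
  · rintro ⟨h0, h1⟩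
    have hx := DFunLike.congr_fun h1 (1, 0)
    have hy := DFunLike.congr_fun h1 (0, 1)
    simp at hx hy
    have hy0 : z.2 ≠ 0 := fun h0' => hc (by simpa [h0'] using h0)
    refine ⟨by tauto, ?_⟩
    field_simp
    linear_combination hy
  · rintro ⟨hx, hy⟩
    rw [hx] at hz
    have hg : (g.eval z.1) ^ 2 = 4 * (a * c / b ^ 2) := by
      simpa [hm', sub_eq_zero] using hz
    constructor
    · rw [hy]
      field_simp at hg ⊢
      linear_combination -hg
    · rw [hx, hy]
      ext <;> simp
      field_simp
      simp

theorem singularities_curveF {a b c : ℂ} (ha : a ≠ 0) (hb : b ≠ 0) (hc : c ≠ 0) {m : ℕ}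
    (hm : m ≠ 0) {p q : ℂ} {g : ℂ[X]} (hdeg : g.natDegree = m)
    (h : C ((m : ℂ) ^ 2) * (g ^ 2 - C (4 * (a * c / b ^ 2))) =
      (X ^ 2 + C p * X + C q) * derivative g ^ 2) :
    Set.ncard {z : ℂ × ℂ | IsSingularAt (curveF a b c g) z} = m - 1 ∧
      ∀ z : ℂ × ℂ, IsSingularAt (curveF a b c g) z → IsNode (curveF a b c g) z := by
  have hd : (derivative g).natDegree = m - 1 := by rw [natDegree_derivative, hdeg]
  have hg' : derivative g ≠ 0 := fun h0 => by
    have := derivative_eq_zero.mp h0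
    omega
  have hm' : (m : ℂ) ≠ 0 := Nat.cast_ne_zero.mpr hm
  have hlin := linear_of_pell hg' h
  have key : ∀ x : ℂ, (derivative g).eval x = 0 →
      g.eval x ≠ 0 ∧ (derivative (derivative g)).eval x ≠ 0 := by
    intro x hx
    have hz := congrArg (eval x) h
    have hl := congrArg (eval x) hlin
    simp only [eval_mul, eval_C, eval_sub, eval_pow, eval_add, eval_X, hx] at hz hl
    have hgx : g.eval x ≠ 0 := fun h0 => by simp [h0, hm', ha, hb, hc] at hz
    refine ⟨hgx, fun h0 => ?_⟩
    simp [h0, hm', hgx] at hl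
  have hset : {z : ℂ × ℂ | IsSingularAt (curveF a b c g) z} =
      (fun x => (x, -(b * g.eval x) / (2 * a))) '' ((derivative g).roots.toFinset : Set ℂ) := by
    ext ⟨x, y⟩
    simp only [Set.mem_ofPred_eq, isSingularAt_curveF_iff ha hb hc hm h, Set.mem_image,
      Finset.mem_coe, Multiset.mem_toFinset, mem_roots hg', IsRoot.def, Prod.mk.injEq]
    constructor
    · rintro ⟨h1, h2⟩
      exact ⟨x, h1, rfl, h2.symm⟩
    · rintro ⟨x', h1, rfl, h2⟩
      exact ⟨h1, h2.symm⟩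
  have hnodup : (derivative g).roots.Nodup := by
    rw [nodup_roots_iff_of_splits hg' (IsAlgClosed.splits _)]
    refine (isCoprime_iff_aeval_ne_zero_of_isAlgClosed ℂ ℂ _ _).mpr fun x => ?_
    by_cases hx : (derivative g).eval x = 0
    · exact Or.inr (by simpa [aeval_def, eval₂_eq_eval_map] using (key x hx).2)
    · exact Or.inl (by simpa [aeval_def, eval₂_eq_eval_map] using hx)
  refine ⟨?_, fun z hz => ⟨hz, ?_⟩⟩
  · rw [hset, Set.ncard_image_of_injective _ (fun x y hxy => (Prod.mk.inj hxy).1),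
      Set.ncard_coe_finset, Multiset.toFinset_card_of_nodup hnodup, ← hd]
    exact (IsAlgClosed.splits _).natDegree_eq_card_roots.symm
  · obtain ⟨hx, hy⟩ := (isSingularAt_curveF_iff ha hb hc hm h z).mp hz
    obtain ⟨hg0, hg2⟩ := key _ hx
    simp [D2_curveF, hx, hy, ha, hb, hg0, hg2]

theorem exists_squarefree_mul_sq {R : Type*} [CommMonoidWithZero R]
    [UniqueFactorizationMonoid R] (a : R) (ha : a ≠ 0) :
    ∃ q r : R, Squarefree q ∧ a = q * r ^ 2 := by
  induction a using UniqueFactorizationMonoid.induction_on_prime with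
  | h₁ => exact absurd rfl ha
  | h₂ x hx => exact ⟨x, 1, hx.squarefree, by simp⟩
  | h₃ a p ha0 hp ih =>
    obtain ⟨q, r, hq, rfl⟩ := ih ha0
    by_cases hpq : p ∣ q
    · obtain ⟨q', rfl⟩ := hpq
      exact ⟨q', p * r, hq.squarefree_of_dvd (dvd_mul_left _ _), by
        rw [mul_pow, sq p]; ac_rfl⟩
    · refine ⟨p * q, r, ?_, by rw [mul_assoc]⟩
      have hrel : IsRelPrime p q := (hp.irreducible.isRelPrime_iff_not_dvd).mpr hpq
      exact squarefree_mul_iff.mpr ⟨hrel, hp.irreducible.squarefree, hq⟩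

theorem isCoprime_sub_C_mul {K : Type*} [Field K] {A B : K[X]} (hAB : IsCoprime A B) {r r' : K}
    (hne : r ≠ r') : IsCoprime (A - C r * B) (A - C r' * B) := by
  obtain ⟨x, y, hxy⟩ := hAB
  have hc : C ((r - r')⁻¹) * (C r - C r') = 1 := by
    rw [← map_sub, ← map_mul, inv_mul_cancel₀ (sub_ne_zero.mpr hne), map_one]
  refine ⟨C ((r - r')⁻¹) * (-C r' * x - y), C ((r - r')⁻¹) * (C r * x + y), ?_⟩
  linear_combination (C ((r - r')⁻¹) * (C r - C r')) * hxy + hc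

/-- A pencil of polynomials in which four members are squares is constant. -/
theorem derivative_eq_zero_of_four_squares {A B : ℂ[X]} (hAB : IsCoprime A B) (r : Fin 4 → ℂ)
    (hr : Function.Injective r) (s : Fin 4 → ℂ[X])
    (hs : ∀ i, Associated (s i ^ 2) (A - C (r i) * B)) :
    derivative A = 0 ∧ derivative B = 0 := by
  rw [← hAB.wronskian_eq_zero_iff]
  by_contra hW
  have hw : ∀ i j, wronskian (A - C (r i) * B) (A - C (r j) * B) =
      C (r i - r j) * wronskian A B := fun i j => by
    simp only [wronskian, derivative_C_mul, map_sub]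
    ring
  have hne : ∀ {i j}, i ≠ j → r i - r j ≠ 0 := fun h => sub_ne_zero.mpr (hr.ne h)
  have hcop : ∀ {i j}, i ≠ j → IsCoprime (s i) (s j) := by
    intro i j hij
    exact (isCoprime_sub_C_mul hAB (hr.ne hij)).mono ((dvd_pow_self _ two_ne_zero).trans (hs i).dvd)
      ((dvd_pow_self _ two_ne_zero).trans (hs j).dvd)
  have hdvd : ∀ i, s i ∣ wronskian A B := by
    intro i
    obtain ⟨u, hu⟩ := hs i
    have e : wronskian A B = wronskian (A - C (r i) * B) B := by
      simp only [wronskian, derivative_sub, derivative_C_mul]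
      ring
    rw [e, ← hu, wronskian]
    simp only [derivative_mul, derivative_sq]
    exact ⟨s i * (u : ℂ[X]) * derivative B -
      (C 2 * derivative (s i) * (u : ℂ[X]) + s i * derivative (u : ℂ[X])) * B, by ring⟩
  have hprod : ∏ i, s i ∣ wronskian A B :=
    Finset.prod_dvd_of_coprime (fun i _ j _ hij => hcop hij) fun i _ => hdvd i
  have hsum : ∑ i, (s i).natDegree ≤ (wronskian A B).natDegree := by
    rw [← natDegree_prod _ _ fun i _ h0 => hW (zero_dvd_iff.mp (h0 ▸ hdvd i))]
    exact natDegree_le_of_dvd hprod hW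
  have hdeg : ∀ i, (A - C (r i) * B).natDegree = 2 * (s i).natDegree := fun i => by
    rw [← natDegree_pow]
    exact (natDegree_eq_of_degree_eq (degree_eq_degree_of_associated (hs i))).symm
  have hlt : ∀ {i j}, i ≠ j →
      (wronskian A B).natDegree < 2 * (s i).natDegree + 2 * (s j).natDegree := by
    intro i j hij
    rw [← hdeg, ← hdeg, ← natDegree_C_mul (hne hij), ← hw]
    refine natDegree_wronskian_lt_add ?_
    rw [hw]
    exact mul_ne_zero (C_ne_zero.mpr (hne hij)) hW
  have h1 := hlt (show (0 : Fin 4) ≠ 1 by decide)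
  have h2 := hlt (show (2 : Fin 4) ≠ 3 by decide)
  simp only [Fin.sum_univ_four] at hsum
  omega

theorem aeval_ne_zero_of_nonconstant {u : RatFunc ℂ} (hu : ∀ r : ℂ, u ≠ RatFunc.C r)
    {f : ℂ[X]} (hf : f ≠ 0) : aeval u f ≠ 0 := by
  rw [(IsAlgClosed.splits f).eq_prod_roots, map_mul, map_multiset_prod, Multiset.map_map, aeval_C]
  refine mul_ne_zero (by simpa using hf) (Multiset.prod_ne_zero ?_)
  simp only [Multiset.mem_map, Function.comp_apply, map_sub, aeval_X, aeval_C, not_exists,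
    not_and, sub_eq_zero]
  exact fun r _ => hu r

/-- A squarefree monic polynomial of even degree whose value at a nonconstant rational function is
a square has degree less than four. -/
theorem natDegree_lt_four_of_aeval_eq_sq {u s : RatFunc ℂ} (hu : ∀ r : ℂ, u ≠ RatFunc.C r)
    {Q : ℂ[X]} (hQ : Squarefree Q) (hmon : Q.Monic) (heven : Even Q.natDegree)
    (h : aeval u Q = s ^ 2) : Q.natDegree < 4 := by
  by_contra! h4
  set A := u.num with hA
  set B := u.denom with hB
  have hAB : IsCoprime A B := u.isCoprime_num_denom
  have hB0 : algebraMap ℂ[X] (RatFunc ℂ) B ≠ 0 := RatFunc.algebraMap_ne_zero u.denom_ne_zero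
  have huAB : algebraMap ℂ[X] (RatFunc ℂ) A = u * algebraMap _ _ B := by
    rw [← div_eq_iff hB0]
    exact u.num_div_denom
  have hsep : Q.Separable := PerfectField.separable_iff_squarefree.mpr hQ
  have hnodup : Q.roots.Nodup := nodup_roots hsep
  have hcard : Q.roots.toFinset.card = Q.natDegree := by
    rw [Multiset.toFinset_card_of_nodup hnodup]
    exact (IsAlgClosed.splits Q).natDegree_eq_card_roots.symm
  have hQprod : Q = ∏ r ∈ Q.roots.toFinset, (X - C r) := by
    rw [Finset.prod, Multiset.toFinset_val, hnodup.dedup]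
    exact (IsAlgClosed.splits Q).eq_prod_roots_of_monic hmon
  have hprod : algebraMap ℂ[X] (RatFunc ℂ) (∏ r ∈ Q.roots.toFinset, (A - C r * B)) =
      algebraMap _ _ B ^ Q.natDegree * aeval u Q := by
    have hQu : aeval u Q = ∏ r ∈ Q.roots.toFinset, (u - RatFunc.C r) := by
      conv_lhs => rw [hQprod]
      simp [map_prod, RatFunc.algebraMap_eq_C]
    rw [hQu, ← hcard, map_prod, ← Finset.prod_const, ← Finset.prod_mul_distrib]
    refine Finset.prod_congr rfl fun r _ => ?_
    rw [map_sub, map_mul, huAB, RatFunc.algebraMap_C]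
    ring
  obtain ⟨k, hk⟩ := heven
  obtain ⟨c, hc⟩ : ∃ c : ℂ[X], ∏ r ∈ Q.roots.toFinset, (A - C r * B) = c ^ 2 := by
    have e : (algebraMap ℂ[X] (RatFunc ℂ) B ^ k * s) ^ 2 =
        algebraMap ℂ[X] (RatFunc ℂ) (∏ r ∈ Q.roots.toFinset, (A - C r * B)) := by
      rw [hprod, h, hk]
      ring
    obtain ⟨c, hc⟩ := IsIntegrallyClosed.exists_algebraMap_eq_of_isIntegral_pow (R := ℂ[X])
      (x := algebraMap ℂ[X] (RatFunc ℂ) B ^ k * s) two_pos (e ▸ isIntegral_algebraMap)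
    refine ⟨c, RatFunc.algebraMap_injective ℂ ?_⟩
    rw [← e, ← hc, map_pow]
  have hsq : ∀ r ∈ Q.roots.toFinset, ∃ d : ℂ[X], Associated (d ^ 2) (A - C r * B) := by
    intro r hr
    rw [← Finset.mul_prod_erase _ _ hr] at hc
    exact exists_associated_pow_of_mul_eq_pow'
      (IsCoprime.prod_right fun r' hr' =>
        isCoprime_sub_C_mul hAB (Finset.ne_of_mem_erase hr').symm) hc
  obtain ⟨f⟩ : Nonempty (Fin 4 ↪ Q.roots.toFinset) :=
    Function.Embedding.nonempty_of_card_le (by simpa [hcard] using h4)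
  choose d hd using hsq
  obtain ⟨hA', hB'⟩ := derivative_eq_zero_of_four_squares hAB (fun i => (f i : ℂ))
    (Subtype.val_injective.comp f.injective) (fun i => d _ (f i).2) fun i => hd _ (f i).2
  rw [derivative_eq_zero] at hA' hB'
  refine hu (A.coeff 0 / B.coeff 0) ?_
  rw [← u.num_div_denom, ← hA, ← hB, eq_C_of_natDegree_eq_zero hA',
    eq_C_of_natDegree_eq_zero hB']
  simp [RatFunc.algebraMap_C]

theorem pell_of_isRationalMember {a b c : ℂ} (ha : a ≠ 0) (hb : b ≠ 0) (hc : c ≠ 0) {m : ℕ}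
    (hm : m ≠ 0) {g : ℂ[X]} (hg : g.Monic) (hd : g.natDegree = m)
    (h : IsRationalMember a b c g) :
    ∃ p q : ℂ, C ((m : ℂ) ^ 2) * (g ^ 2 - C (4 * (a * c / b ^ 2))) =
      (X ^ 2 + C p * X + C q) * derivative g ^ 2 := by
  obtain ⟨u, v, hu, huv⟩ := h
  set γ := a * c / b ^ 2 with hγ
  have hγ0 : γ ≠ 0 := by positivity
  have hC : ∀ {r : ℂ}, r ≠ 0 → RatFunc.C r ≠ 0 := fun hr =>
    (_root_.map_ne_zero RatFunc.C).mpr hr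
  have hv : v ≠ 0 := by
    rintro rfl
    exact hC hc (by simpa using huv)
  set P := g ^ 2 - C (4 * γ) with hP
  have hPs : aeval u P =
      ((RatFunc.C a * v ^ 2 - RatFunc.C c) / (RatFunc.C b * v)) ^ 2 := by
    have e : RatFunc.C (4 * γ) * RatFunc.C b ^ 2 = 4 * RatFunc.C a * RatFunc.C c := by
      rw [← map_pow, ← map_mul, show 4 * γ * b ^ 2 = 4 * a * c by rw [hγ]; field_simp,
        map_mul, map_mul, map_ofNat]
    rw [div_pow, eq_div_iff (pow_ne_zero 2 (mul_ne_zero (hC hb) hv)), hP, map_sub, map_pow, aeval_C,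
      RatFunc.algebraMap_eq_C]
    linear_combination (RatFunc.C b * v * aeval u g - RatFunc.C a * v ^ 2 - RatFunc.C c) * huv -
      v ^ 2 * e
  have hPdeg : P.natDegree = 2 * m := by
    rw [hP, natDegree_sub_C, hg.natDegree_pow, hd]
  have hPmon : P.Monic := (hg.pow 2).sub_of_left <| degree_C_le.trans_lt <|
    natDegree_pos_iff_degree_pos.mp (by rw [hg.natDegree_pow, hd]; omega)
  obtain ⟨Q, R, hQ, hR, hsq, hPQR⟩ :
      ∃ Q R : ℂ[X], Q.Monic ∧ R.Monic ∧ Squarefree Q ∧ P = Q * R ^ 2 := by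
    obtain ⟨Q, R, hsq, hPQR⟩ := exists_squarefree_mul_sq P hPmon.ne_zero
    have hlc : Q.leadingCoeff * R.leadingCoeff ^ 2 = 1 := by
      rw [← leadingCoeff_pow, ← leadingCoeff_mul, ← hPQR, hPmon]
    have hr : R.leadingCoeff ≠ 0 := fun h0 => by simp [h0] at hlc
    refine ⟨Q * C (R.leadingCoeff ^ 2), R * C R.leadingCoeff⁻¹, ?_, ?_, ?_, ?_⟩
    · rw [Monic, leadingCoeff_mul, leadingCoeff_C, hlc]
    · rw [Monic, leadingCoeff_mul, leadingCoeff_C, mul_inv_cancel₀ hr]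
    · refine hsq.squarefree_of_dvd (Associated.dvd ?_)
      exact (associated_mul_unit_right Q _ (isUnit_C.mpr (pow_ne_zero 2 hr).isUnit)).symm
    · have e : C R.leadingCoeff * C R.leadingCoeff⁻¹ = 1 := by
        rw [← map_mul, mul_inv_cancel₀ hr, map_one]
      rw [hPQR, map_pow]
      linear_combination -Q * R ^ 2 * (C R.leadingCoeff * C R.leadingCoeff⁻¹ + 1) * e
  have hdeg : Q.natDegree + 2 * R.natDegree = 2 * m := by
    rw [← hPdeg, hPQR, hQ.natDegree_mul (hR.pow 2), hR.natDegree_pow]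
  have hQ4 : Q.natDegree < 4 := by
    have hRu := aeval_ne_zero_of_nonconstant hu hR.ne_zero
    refine natDegree_lt_four_of_aeval_eq_sq hu hsq hQ (by grind)
      (s := (RatFunc.C a * v ^ 2 - RatFunc.C c) / (RatFunc.C b * v) / aeval u R) ?_
    rw [div_pow, ← hPs, hPQR, map_mul, map_pow, mul_div_cancel_right₀ _ (pow_ne_zero 2 hRu)]
  have hg' : derivative g ≠ 0 := fun h0 => hm (hd ▸ derivative_eq_zero.mp h0)
  have hcop : IsCoprime R g := by
    have e : (C (4 * γ) * C ((4 * γ)⁻¹) : ℂ[X]) = 1 := by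
      rw [← map_mul, mul_inv_cancel₀ (mul_ne_zero (by norm_num) hγ0), map_one]
    refine ⟨-C ((4 * γ)⁻¹) * Q * R, C ((4 * γ)⁻¹) * g, ?_⟩
    linear_combination C ((4 * γ)⁻¹) * (hPQR - hP) + e
  have hdvd : R ∣ derivative g := by
    have hPd : C 2 * g * derivative g = derivative P := by
      rw [hP, derivative_sub, derivative_C, derivative_sq, sub_zero]
    have h1 : R ∣ C 2 * g * derivative g := by
      rw [hPd, hPQR, derivative_mul, derivative_sq]
      exact ⟨derivative Q * R + Q * (C 2 * derivative R), by ring⟩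
    have h2 : IsCoprime R (C 2 * g) :=
      IsCoprime.mul_right ⟨0, C (2⁻¹), by rw [zero_mul, zero_add, ← map_mul]; norm_num⟩ hcop
    exact h2.dvd_of_dvd_mul_left h1
  have hgd : (derivative g).natDegree = m - 1 := by rw [natDegree_derivative, hd]
  have hRle := natDegree_le_of_dvd hdvd hg'
  have hQ2 : Q.natDegree = 2 := by omega
  obtain ⟨k, hk⟩ := hdvd
  have hk0 : k ≠ 0 := right_ne_zero_of_mul (hk ▸ hg')
  have hkd : k.natDegree = 0 := by
    have := hR.natDegree_mul' hk0
    rw [← hk] at this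
    omega
  have hkm : k = C (m : ℂ) := by
    have e : (derivative g).leadingCoeff = m := by
      rw [leadingCoeff, hgd, coeff_derivative, Nat.sub_add_cancel (Nat.pos_of_ne_zero hm), ← hd,
        hg.coeff_natDegree, hd, one_mul]
      exact_mod_cast Nat.sub_add_cancel (Nat.pos_of_ne_zero hm)
    rw [hk, leadingCoeff_mul, hR, one_mul, leadingCoeff, hkd] at e
    rw [eq_C_of_natDegree_eq_zero hkd, e]
  refine ⟨Q.coeff 1, Q.coeff 0, ?_⟩
  have hQq : Q = X ^ 2 + C (Q.coeff 1) * X + C (Q.coeff 0) := by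
    have h2 : Q.coeff 2 = 1 := hQ2 ▸ hQ.coeff_natDegree
    conv_lhs => rw [Q.as_sum_range_C_mul_X_pow, hQ2]
    simp [Finset.sum_range_succ, h2]
    ring
  rw [← hQq, hPQR, hk, hkm, map_pow]
  ring

theorem eq_dickson_comp_of_pell {m : ℕ} (hm : m ≠ 0) {γ p q : ℂ} {g : ℂ[X]} (hg : g.Monic)
    (hd : g.natDegree = m)
    (h : C ((m : ℂ) ^ 2) * (g ^ 2 - C (4 * γ)) =
      (X ^ 2 + C p * X + C q) * derivative g ^ 2) :
    ∃ β t : ℂ, β ^ m = γ ∧ g = (dickson 1 β m).comp (X + C t) := by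
  obtain ⟨n, rfl⟩ := Nat.exists_eq_add_one_of_ne_zero hm
  set β := (p ^ 2 / 4 - q) / 4 with hβ
  obtain ⟨hDm, hDd⟩ := dickson_one_monic_natDegree β n
  set g₀ := g.comp (X + C (-p / 2)) with hg₀
  have hm₀ : g₀.Monic := hg.comp_X_add_C _
  have hd₀ : g₀.natDegree = n + 1 := by rw [hg₀, natDegree_comp, natDegree_X_add_C, mul_one, hd]
  have h₀ := pell_comp h (-p / 2)
  rw [← hg₀, show p + 2 * (-p / 2) = 0 by ring,
    show (-p / 2) ^ 2 + p * (-p / 2) + q = -(4 * β) by rw [hβ]; ring] at h₀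
  have hD := dickson_one_pell β (n + 1)
  rw [show (X ^ 2 - C (4 * β) : ℂ[X]) = X ^ 2 + C 0 * X + C (-(4 * β)) by
    rw [map_neg, map_zero]; ring] at hD
  have hne : ∀ {f : ℂ[X]}, f.natDegree = n + 1 → derivative f ≠ 0 := fun hf h0 => by
    rw [derivative_eq_zero, hf] at h0
    omega
  have heq : g₀ = dickson 1 β (n + 1) :=
    eq_of_linear hm₀ hDm hd₀ hDd (linear_of_pell (hne hd₀) h₀) (linear_of_pell (hne hDd) hD)
  refine ⟨β, p / 2, ?_, ?_⟩
  · rw [heq] at h₀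
    have e := congrArg (eval 0) (h₀.trans hD.symm)
    have hn : ((n + 1 : ℕ) : ℂ) ≠ 0 := Nat.cast_ne_zero.mpr hm
    simp only [eval_mul, eval_sub, eval_C] at e
    have e' := mul_left_cancel₀ (pow_ne_zero 2 hn) e
    linear_combination e' / 4
  · rw [← heq, hg₀, comp_assoc]
    simp [add_assoc, neg_div]

theorem isRationalMember_dickson_comp {a b c : ℂ} (ha : a ≠ 0) (hb : b ≠ 0) {m : ℕ} {β : ℂ}
    (hβ : β ^ m = a * c / b ^ 2) (t : ℂ) :
    IsRationalMember a b c ((dickson 1 β m).comp (X + C t)) := by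
  have hX : (RatFunc.X : RatFunc ℂ) ≠ 0 := RatFunc.X_ne_zero
  refine ⟨RatFunc.X + RatFunc.C β / RatFunc.X - RatFunc.C t,
    -(RatFunc.C (b / a) * RatFunc.X ^ m), fun r hr => ?_, ?_⟩
  · have e : algebraMap ℂ[X] (RatFunc ℂ) (X ^ 2 + C β - C (r + t) * X) = 0 := by
      simp only [map_sub, map_add, map_mul, map_pow, RatFunc.algebraMap_X, RatFunc.algebraMap_C]
      field_simp at hr
      linear_combination hr
    rw [map_eq_zero_iff _ (RatFunc.algebraMap_injective ℂ)] at e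
    have := congrArg (fun f => coeff f 2) e
    simp at this
  · have e : aeval (RatFunc.X + RatFunc.C β / RatFunc.X) (dickson 1 β m) =
        RatFunc.X ^ m + (RatFunc.C β / RatFunc.X) ^ m := by
      rw [← dickson_one_eval_add, mul_div_cancel₀ _ hX, ← RatFunc.algebraMap_eq_C, ← map_dickson,
        eval_map_algebraMap]
    have hab : RatFunc.C a * RatFunc.C (b / a) = RatFunc.C b := by
      rw [← map_mul, mul_div_cancel₀ _ ha]
    have hc : RatFunc.C (b / a) * RatFunc.C b * RatFunc.C β ^ m = RatFunc.C c := by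
      rw [← map_pow, ← map_mul, ← map_mul, hβ]
      congr 1
      field_simp
    rw [aeval_comp, map_add, aeval_X, aeval_C, RatFunc.algebraMap_eq_C, sub_add_cancel, e,
      ← hc, ← hab, div_pow]
    field_simp
    ring

theorem dickson_one_comp_pell (β : ℂ) (n : ℕ) (t : ℂ) :
    C ((n : ℂ) ^ 2) * ((dickson 1 β n).comp (X + C t) ^ 2 - C (4 * β ^ n)) =
      (X ^ 2 + C (2 * t) * X + C (t ^ 2 - 4 * β)) *
        derivative ((dickson 1 β n).comp (X + C t)) ^ 2 := by
  have h := dickson_one_pell β n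
  rw [show (X ^ 2 - C (4 * β) : ℂ[X]) = X ^ 2 + C 0 * X + C (-(4 * β)) by
    rw [map_neg, map_zero]; ring] at h
  have h' := pell_comp h t
  rwa [show 0 + 2 * t = 2 * t by ring, show t ^ 2 + 0 * t + -(4 * β) = t ^ 2 - 4 * β by ring] at h'

theorem exists_injective_range_eq_nthRoots {m : ℕ} (hm : m ≠ 0) {γ : ℂ} (hγ : γ ≠ 0) :
    ∃ β : Fin m → ℂ, Function.Injective β ∧ ∀ x : ℂ, x ^ m = γ ↔ ∃ k, β k = x := by
  have hζ := Complex.isPrimitiveRoot_exp m hm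
  have hcard : (nthRoots m γ).toFinset.card = m := by
    rw [Multiset.toFinset_card_of_nodup (hζ.nthRoots_nodup hγ), hζ.card_nthRoots,
      if_pos (IsAlgClosed.exists_pow_nat_eq γ (Nat.pos_of_ne_zero hm))]
  let e := (Finset.equivFinOfCardEq hcard).symm
  refine ⟨fun k => e k, Subtype.val_injective.comp e.injective, fun x => ?_⟩
  rw [← mem_nthRoots (Nat.pos_of_ne_zero hm), ← Multiset.mem_toFinset]
  constructor
  · exact fun hx => ⟨e.symm ⟨x, hx⟩, by simp⟩
  · rintro ⟨k, rfl⟩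
    exact (e k).2

end

/-- among the curves a y² + b y g(x) + c with g monic of degree m, the
rational ones form exactly m disjoint one-dimensional families, each family being the
shift-orbit of a unique representative with vanishing x^{m−1}-coefficient; moreover all
these rational curves have exactly m − 1 nodes in ℂ² as their only singularities. -/
theorem rational_members_of_vertical_conic_family
    (m : ℕ) (hm : 2 ≤ m) (a b c : ℂ) (ha : a ≠ 0) (hb : b ≠ 0) (hc : c ≠ 0) :
    ∃ gs : Fin m → Polynomial ℂ,
      (∀ k, (gs k).Monic ∧ (gs k).natDegree = m ∧ (gs k).coeff (m - 1) = 0) ∧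
      (∀ k l : Fin m, ∀ s t : ℂ,
        (gs k).comp (Polynomial.X + Polynomial.C s) =
          (gs l).comp (Polynomial.X + Polynomial.C t) → k = l ∧ s = t) ∧
      (∀ g : Polynomial ℂ,
        (g.Monic ∧ g.natDegree = m ∧ IsRationalMember a b c g) ↔
          ∃ k : Fin m, ∃ t : ℂ, g = (gs k).comp (Polynomial.X + Polynomial.C t)) ∧
      (∀ k : Fin m, ∀ t : ℂ,
        ((gs k).comp (Polynomial.X + Polynomial.C t)).coeff (m - 1) = 0 → t = 0) ∧
      (∀ k : Fin m, ∀ t : ℂ,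
        Set.ncard {z : ℂ × ℂ |
            IsSingularAt (curveF a b c ((gs k).comp (Polynomial.X + Polynomial.C t))) z}
          = m - 1 ∧
        ∀ z : ℂ × ℂ,
          IsSingularAt (curveF a b c ((gs k).comp (Polynomial.X + Polynomial.C t))) z →
          IsNode (curveF a b c ((gs k).comp (Polynomial.X + Polynomial.C t))) z) := by
  have hm0 : m ≠ 0 := by omega
  obtain ⟨n, rfl⟩ := Nat.exists_eq_add_one_of_ne_zero hm0
  have hγ : a * c / b ^ 2 ≠ 0 := by positivity
  obtain ⟨β, hβinj, hβ⟩ := exists_injective_range_eq_nthRoots hm0 hγ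
  have hβm : ∀ k, β k ^ (n + 1) = a * c / b ^ 2 := fun k => (hβ _).mpr ⟨k, rfl⟩
  have hmd := fun k => dickson_one_monic_natDegree (β k) n
  have hmon : ∀ k t,
      ((Polynomial.dickson 1 (β k) (n + 1)).comp (Polynomial.X + Polynomial.C t)).Monic :=
    fun k t => (hmd k).1.comp_X_add_C t
  have hdeg : ∀ k t, ((Polynomial.dickson 1 (β k) (n + 1)).comp
      (Polynomial.X + Polynomial.C t)).natDegree = n + 1 := fun k t => by
    rw [Polynomial.natDegree_comp, Polynomial.natDegree_X_add_C, mul_one, (hmd k).2]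
  have hder : ∀ k t, Polynomial.derivative ((Polynomial.dickson 1 (β k) (n + 1)).comp
      (Polynomial.X + Polynomial.C t)) ≠ 0 := fun k t h0 => by
    rw [Polynomial.derivative_eq_zero, hdeg] at h0
    omega
  have hpell := fun k t => hβm k ▸ dickson_one_comp_pell (β k) (n + 1) t
  have hcoeff : ∀ k t, ((Polynomial.dickson 1 (β k) (n + 1)).comp
      (Polynomial.X + Polynomial.C t)).coeff n = (n + 1) * t := fun k t => by
    have := coeff_pred_of_linear (hmon k t) (hdeg k t) (linear_of_pell (hder k t) (hpell k t))
    linear_combination this / 2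
  refine ⟨fun k => Polynomial.dickson 1 (β k) (n + 1), fun k => ⟨(hmd k).1, (hmd k).2, ?_⟩,
    fun k l s t h => ?_, fun g => ⟨?_, ?_⟩, fun k t h => ?_, fun k t =>
    singularities_curveF ha hb hc hm0 (hdeg k t) (hpell k t)⟩
  · simpa using hcoeff k 0
  · have hl := hpell l t
    rw [← h] at hl
    obtain ⟨h1, h2⟩ := pell_unique (hder k s) (hpell k s) hl
    have hst : s = t := mul_left_cancel₀ two_ne_zero h1
    subst hst
    exact ⟨hβinj (by linear_combination -h2 / 4), rfl⟩
  · rintro ⟨hg, hd, hr⟩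
    obtain ⟨p, q, hpq⟩ := pell_of_isRationalMember ha hb hc hm0 hg hd hr
    obtain ⟨x, t, hx, rfl⟩ := eq_dickson_comp_of_pell hm0 hg hd hpq
    obtain ⟨k, rfl⟩ := (hβ x).mp hx
    exact ⟨k, t, rfl⟩
  · rintro ⟨k, t, rfl⟩
    exact ⟨hmon k t, hdeg k t, isRationalMember_dickson_comp ha hb (hβm k) t⟩
  · have hn : (n + 1 : ℂ) ≠ 0 := Nat.cast_add_one_ne_zero n
    exact (mul_eq_zero.mp ((hcoeff k t).symm.trans h)).resolve_left hn
end

section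
/- Given fixed nonzero coefficients at the three vertices of the triangle Δ₂ (the unique lattice triangle, up to Aff(ℤ²), with two interior integral points and all edges of lattice length 1), there exist exactly five polynomials with Newton triangle Δ₂ and those vertex coefficients defining a curve with an ordinary cusp; furthermore such curves have no other singular points. -/
/-- The polynomial with Newton triangle Δ₂ = conv{(0,0),(2,1),(1,3)} (the unique lattice
triangle, up to Aff(ℤ²), with two interior lattice points (1,1), (1,2) and primitive
edges), with vertex coefficients c₀₀, c₂₁, c₁₃ and interior coefficients A, B. -/
def triPoly (c00 c21 c13 A B : ℂ) : ℂ × ℂ → ℂ := fun z =>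
  c00 + c21 * z.1 ^ 2 * z.2 + c13 * z.1 * z.2 ^ 3 + A * z.1 * z.2 + B * z.1 * z.2 ^ 2

theorem D2_eq_fderiv (F : ℂ × ℂ → ℂ) (hF : ContDiff ℂ 2 F) (z v w : ℂ × ℂ) :
    D2 F z v w = fderiv ℂ (fun p => fderiv ℂ F p w) z v := by
  have hd : DifferentiableAt ℂ (fderiv ℂ F) z :=
    (hF.fderiv_right (m := 1) (by norm_num)).differentiable (by norm_num) z
  rw [D2, iteratedFDeriv_two_apply, fderiv_clm_apply hd (differentiableAt_const w)]
  simp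

theorem D3_eq_fderiv (F : ℂ × ℂ → ℂ) (hF : ContDiff ℂ 3 F) (z v w u : ℂ × ℂ) :
    D3 F z v w u = fderiv ℂ (fun p => D2 F p w u) z v := by
  have hd : DifferentiableAt ℂ (iteratedFDeriv ℂ 2 F) z :=
    hF.differentiable_iteratedFDeriv (by norm_num) z
  have h := hd.hasFDerivAt.continuousMultilinear_apply_const ![w, u]
  unfold D2
  rw [h.fderiv, D3, iteratedFDeriv_succ_apply_left]
  rfl

section triPoly

variable (a b c A B : ℂ)

theorem contDiff_triPoly (n : WithTop ℕ∞) : ContDiff ℂ n (triPoly a b c A B) := by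
  unfold triPoly
  fun_prop

theorem fderiv_triPoly (z v : ℂ × ℂ) :
    fderiv ℂ (triPoly a b c A B) z v =
      (2 * b * z.1 * z.2 + c * z.2 ^ 3 + A * z.2 + B * z.2 ^ 2) * v.1 +
      (b * z.1 ^ 2 + 3 * c * z.1 * z.2 ^ 2 + A * z.1 + 2 * B * z.1 * z.2) * v.2 := by
  have h1 : HasFDerivAt (fun p : ℂ × ℂ => p.1) (ContinuousLinearMap.fst ℂ ℂ ℂ) z :=
    hasFDerivAt_fst
  have h2 : HasFDerivAt (fun p : ℂ × ℂ => p.2) (ContinuousLinearMap.snd ℂ ℂ ℂ) z :=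
    hasFDerivAt_snd
  have h := (((((h1.pow 2).const_mul b).mul h2).const_add a).add
    ((h1.const_mul c).mul (h2.pow 3))).add ((h1.const_mul A).mul h2) |>.add
    ((h1.const_mul B).mul (h2.pow 2))
  have e : fderiv ℂ (triPoly a b c A B) z = _ := h.fderiv
  rw [e]
  simp
  ring

theorem D2_triPoly (z v w : ℂ × ℂ) :
    D2 (triPoly a b c A B) z v w =
      2 * b * z.2 * (v.1 * w.1) +
      (2 * b * z.1 + 3 * c * z.2 ^ 2 + A + 2 * B * z.2) * (v.1 * w.2 + v.2 * w.1) +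
      (6 * c * z.1 * z.2 + 2 * B * z.1) * (v.2 * w.2) := by
  have h1 : HasFDerivAt (fun p : ℂ × ℂ => p.1) (ContinuousLinearMap.fst ℂ ℂ ℂ) z :=
    hasFDerivAt_fst
  have h2 : HasFDerivAt (fun p : ℂ × ℂ => p.2) (ContinuousLinearMap.snd ℂ ℂ ℂ) z :=
    hasFDerivAt_snd
  rw [D2_eq_fderiv _ (contDiff_triPoly a b c A B 2)]
  simp only [fderiv_triPoly]
  have h := ((((((h1.const_mul (2 * b)).mul h2).add ((h2.pow 3).const_mul c)).add
    (h2.const_mul A)).add ((h2.pow 2).const_mul B)).mul_const w.1).add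
    ((((((h1.pow 2).const_mul b).add ((h1.const_mul (3 * c)).mul (h2.pow 2))).add
    (h1.const_mul A)).add ((h1.const_mul (2 * B)).mul h2)).mul_const w.2)
  refine (congrArg (fun L => L v) h.fderiv).trans ?_
  simp
  ring

theorem D3_triPoly (z v : ℂ × ℂ) :
    D3 (triPoly a b c A B) z v v v =
      6 * b * v.1 ^ 2 * v.2 + 3 * (6 * c * z.2 + 2 * B) * v.1 * v.2 ^ 2 +
      6 * c * z.1 * v.2 ^ 3 := by
  have h1 : HasFDerivAt (fun p : ℂ × ℂ => p.1) (ContinuousLinearMap.fst ℂ ℂ ℂ) z :=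
    hasFDerivAt_fst
  have h2 : HasFDerivAt (fun p : ℂ × ℂ => p.2) (ContinuousLinearMap.snd ℂ ℂ ℂ) z :=
    hasFDerivAt_snd
  rw [D3_eq_fderiv _ (contDiff_triPoly a b c A B 3)]
  simp only [D2_triPoly]
  have h := (((h2.const_mul (2 * b)).mul_const (v.1 * v.1)).add
    (((((h1.const_mul (2 * b)).add ((h2.pow 2).const_mul (3 * c))).add_const A).add
    (h2.const_mul (2 * B))).mul_const (v.1 * v.2 + v.2 * v.1))).add
    ((((h1.const_mul (6 * c)).mul h2).add (h1.const_mul (2 * B))).mul_const (v.2 * v.2))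
  refine (congrArg (fun L => L v) h.fderiv).trans ?_
  simp
  ring

theorem isSingularAt_triPoly_iff (z : ℂ × ℂ) :
    IsSingularAt (triPoly a b c A B) z ↔
      a + b * z.1 ^ 2 * z.2 + c * z.1 * z.2 ^ 3 + A * z.1 * z.2 + B * z.1 * z.2 ^ 2 = 0 ∧
      2 * b * z.1 * z.2 + c * z.2 ^ 3 + A * z.2 + B * z.2 ^ 2 = 0 ∧
      b * z.1 ^ 2 + 3 * c * z.1 * z.2 ^ 2 + A * z.1 + 2 * B * z.1 * z.2 = 0 := by
  refine and_congr Iff.rfl ⟨fun h => ⟨?_, ?_⟩, fun ⟨hx, hy⟩ => ?_⟩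
  · simpa [h, eq_comm] using fderiv_triPoly a b c A B z (1, 0)
  · simpa [h, eq_comm] using fderiv_triPoly a b c A B z (0, 1)
  · ext <;> simp [fderiv_triPoly, hx, hy]

variable {a b c A B}

/-- In the torus, the singular points are described by three equations that are linear in the
coefficients. -/
theorem isSingularAt_triPoly_iff_of_ne_zero {z : ℂ × ℂ} (hx : z.1 ≠ 0) (hy : z.2 ≠ 0) :
    IsSingularAt (triPoly a b c A B) z ↔
      b * z.1 ^ 2 * z.2 = a ∧ B * z.2 = b * z.1 - 2 * c * z.2 ^ 2 ∧
      A = c * z.2 ^ 2 - 3 * (b * z.1) := by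
  rw [isSingularAt_triPoly_iff]
  constructor
  · rintro ⟨h, h1, h2⟩
    have e1 : 2 * b * z.1 + c * z.2 ^ 2 + A + B * z.2 = 0 :=
      mul_left_cancel₀ hy (by linear_combination h1)
    have e2 : b * z.1 + 3 * c * z.2 ^ 2 + A + 2 * B * z.2 = 0 :=
      mul_left_cancel₀ hx (by linear_combination h2)
    exact ⟨by linear_combination z.1 * h1 - h, by linear_combination e2 - e1,
      by linear_combination 2 * e1 - e2⟩
  · rintro ⟨h, hB, hA⟩
    refine ⟨?_, ?_, ?_⟩
    · linear_combination -h + z.1 * z.2 * hA + z.1 * z.2 * hB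
    · linear_combination z.2 * hA + z.2 * hB
    · linear_combination z.1 * hA + 2 * z.1 * hB

theorem isOrdinaryCusp_triPoly_iff (hb : b ≠ 0) (hc : c ≠ 0) {z : ℂ × ℂ}
    (hx : z.1 ≠ 0) (hy : z.2 ≠ 0) :
    IsOrdinaryCusp (triPoly a b c A B) z ↔
      z.2 ^ 5 = 9 * a * b / (16 * c ^ 2) ∧ z.1 = -4 * c * z.2 ^ 2 / (3 * b) ∧
      A = 5 * c * z.2 ^ 2 ∧ B = -10 / 3 * c * z.2 := by
  unfold IsOrdinaryCusp
  rw [isSingularAt_triPoly_iff_of_ne_zero hx hy]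
  constructor
  · rintro ⟨⟨h, hB, hA⟩, -, v, hv, hker, -⟩
    have k1 := hker (1, 0)
    have k2 := hker (0, 1)
    simp only [D2_triPoly, mul_one, mul_zero, add_zero, zero_add] at k1 k2
    have hdet : 2 * b * z.2 * (6 * c * z.1 * z.2 + 2 * B * z.1) -
        (2 * b * z.1 + 3 * c * z.2 ^ 2 + A + 2 * B * z.2) ^ 2 = 0 := by
      by_contra hne
      refine hv (Prod.ext (mul_left_cancel₀ hne ?_) (mul_left_cancel₀ hne ?_))
      · simp only [Prod.fst_zero, mul_zero]
        linear_combination (6 * c * z.1 * z.2 + 2 * B * z.1) * k1 -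
          (2 * b * z.1 + 3 * c * z.2 ^ 2 + A + 2 * B * z.2) * k2
      · simp only [Prod.snd_zero, mul_zero]
        linear_combination (2 * b * z.2) * k2 -
          (2 * b * z.1 + 3 * c * z.2 ^ 2 + A + 2 * B * z.2) * k1
    have hxy : 2 * b * z.1 + 3 * c * z.2 ^ 2 + A + 2 * B * z.2 = b * z.1 := by
      linear_combination 2 * hB + hA
    rw [hxy] at hdet
    have hbx : 3 * b * z.1 = -4 * c * z.2 ^ 2 := by
      refine mul_left_cancel₀ (mul_ne_zero hb hx) ?_
      linear_combination hdet - 4 * b * z.1 * hB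
    refine ⟨?_, ?_, ?_, mul_right_cancel₀ hy ?_⟩
    · rw [eq_div_iff (by simp [hc])]
      linear_combination 9 * b * h - (3 * b * z.1 - 4 * c * z.2 ^ 2) * z.2 * hbx
    · rw [eq_div_iff (by simp [hb])]
      linear_combination hbx
    · linear_combination hA - hbx
    · linear_combination hB + hbx / 3
  · rintro ⟨h5, h1, rfl, rfl⟩
    rw [eq_div_iff (by simp [hc])] at h5
    rw [eq_div_iff (by simp [hb])] at h1
    refine ⟨⟨?_, ?_, ?_⟩, ?_, (2 * c * z.2, 3 * b), ?_, ?_, ?_⟩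
    · refine mul_left_cancel₀ (mul_ne_zero (by norm_num : (9 : ℂ) ≠ 0) hb) ?_
      linear_combination h5 + (3 * b * z.1 - 4 * c * z.2 ^ 2) * z.2 * h1
    · linear_combination -h1 / 3
    · linear_combination h1
    · intro h
      have h0 : D2 (triPoly a b c (5 * c * z.2 ^ 2) (-10 / 3 * c * z.2)) z (1, 0) (1, 0) = 0 := by
        simp [D2, h]
      simp [D2_triPoly, hb, hy] at h0
    · simp [hb]
    · intro w
      rw [D2_triPoly]
      linear_combination (4 * c * z.2 * w.2 / 3 + 2 * b * w.1 - 2 / 3 * c * z.2 * w.2) * h1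
    · have e : D3 (triPoly a b c (5 * c * z.2 ^ 2) (-10 / 3 * c * z.2)) z
          (2 * c * z.2, 3 * b) (2 * c * z.2, 3 * b) (2 * c * z.2, 3 * b) =
          -180 * b ^ 2 * c ^ 2 * z.2 ^ 2 := by
        rw [D3_triPoly]
        linear_combination 54 * c * b ^ 2 * h1
      rw [e]
      simp [hb, hc, hy]

end triPoly

theorem Complex.ncard_setOf_pow_eq {n : ℕ} (hn : n ≠ 0) {K : ℂ} (hK : K ≠ 0) :
    {y : ℂ | y ^ n = K}.ncard = n := by
  have hζ := Complex.isPrimitiveRoot_exp n hn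
  have hset : {y : ℂ | y ^ n = K} = ↑(Polynomial.nthRoots n K).toFinset := by
    ext y
    simp [Polynomial.mem_nthRoots (Nat.pos_of_ne_zero hn)]
  rw [hset, Set.ncard_coe_finset, Multiset.toFinset_card_of_nodup (hζ.nthRoots_nodup hK),
    hζ.card_nthRoots, if_pos (IsAlgClosed.exists_pow_nat_eq K (Nat.pos_of_ne_zero hn))]

/-- given fixed nonzero vertex coefficients, there are exactly five choices
of the interior coefficients for which the curve has an ordinary cusp (in the torus), and
such curves have no other singular points. -/
theorem five_cuspidal_polynomials_triangle
    (c00 c21 c13 : ℂ) (h00 : c00 ≠ 0) (h21 : c21 ≠ 0) (h13 : c13 ≠ 0) :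
    Set.ncard {AB : ℂ × ℂ | ∃ z : ℂ × ℂ, z.1 ≠ 0 ∧ z.2 ≠ 0 ∧
        IsOrdinaryCusp (triPoly c00 c21 c13 AB.1 AB.2) z} = 5 ∧
    ∀ A B : ℂ, ∀ z : ℂ × ℂ, z.1 ≠ 0 → z.2 ≠ 0 →
      IsOrdinaryCusp (triPoly c00 c21 c13 A B) z →
      ∀ w : ℂ × ℂ, w.1 ≠ 0 → w.2 ≠ 0 →
        IsSingularAt (triPoly c00 c21 c13 A B) w → w = z := by
  constructor
  · have hK : 9 * c00 * c21 / (16 * c13 ^ 2) ≠ 0 := by simp [h00, h21, h13]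
    have himage : {AB : ℂ × ℂ | ∃ z : ℂ × ℂ, z.1 ≠ 0 ∧ z.2 ≠ 0 ∧
        IsOrdinaryCusp (triPoly c00 c21 c13 AB.1 AB.2) z} =
        (fun y : ℂ => (5 * c13 * y ^ 2, -10 / 3 * c13 * y)) ''
          {y : ℂ | y ^ 5 = 9 * c00 * c21 / (16 * c13 ^ 2)} := by
      ext ⟨A, B⟩
      constructor
      · rintro ⟨z, hx, hy, hz⟩
        obtain ⟨h5, -, hA, hB⟩ := (isOrdinaryCusp_triPoly_iff h21 h13 hx hy).1 hz
        exact ⟨z.2, h5, Prod.ext hA.symm hB.symm⟩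
      · rintro ⟨y, h5, hAB⟩
        obtain ⟨rfl, rfl⟩ := Prod.mk.inj hAB
        have hy : y ≠ 0 := by
          rintro rfl
          exact hK (by simpa using h5.symm)
        have hx : -4 * c13 * y ^ 2 / (3 * c21) ≠ 0 := by simp [h13, hy, h21]
        exact ⟨(-4 * c13 * y ^ 2 / (3 * c21), y), hx, hy,
          (isOrdinaryCusp_triPoly_iff h21 h13 hx hy).2 ⟨h5, rfl, rfl, rfl⟩⟩
    rw [himage, Set.ncard_image_of_injective, Complex.ncard_setOf_pow_eq (by norm_num) hK]
    intro y y' h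
    exact mul_left_cancel₀ (by simp [h13]) (Prod.mk.inj h).2
  · intro A B z hx hy hz w hwx hwy hw
    obtain ⟨-, h1, rfl, rfl⟩ := (isOrdinaryCusp_triPoly_iff h21 h13 hx hy).1 hz
    obtain ⟨-, hB, hA⟩ := (isSingularAt_triPoly_iff_of_ne_zero hwx hwy).1 hw
    have hsq : c13 * (w.2 - z.2) ^ 2 = 0 := by
      linear_combination (hA + 3 * hB) / 5
    have hy' : w.2 = z.2 := by simpa [h13, sub_eq_zero] using hsq
    refine Prod.ext (mul_left_cancel₀ h21 ?_) hy'
    rw [eq_div_iff (by simp [h21])] at h1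
    rw [hy'] at hB
    linear_combination -hB - h1 / 3
end
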